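/- Let φ be a monotonic nonessential enhancement of site percolation on the triangular lattice and let s ∈ [0,1]. Then: (i) if lim_{p↓p_c} log θ(p)/log(p−p_c) = β, then lim_{p↓p_c} log θ(p,s)/log(p−p_c) = β; (ii) if lim_{|x|→∞} log τ_{p_c}(x)/log|x| = −η, then lim_{|x|→∞} log τ_{p_c,s}(x)/log|x| = −η; (iii) if for every p ∈ (0,p_c) the correlation length ξ(p) is well-defined and lim_{p↑p_c} log ξ(p)/log(p_c−p) = −ν, then ξ(p,s) is well-defined and lim_{p↑p_c} log ξ(p,s)/log(p_c−p) = −ν; (iv) if lim_{p↑p_c} log χ(p)/log(p_c−p) = −γ, then lim_{p↑p_c} log χ(p,s)/log(p_c−p) = −γ. (For independent site percolation on the triangular lattice these four exponents are known to exist, so the exponents of the enhanced process exist and have the same numerical values.) -/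

import Mathlib

open MeasureTheory Filter Set Topology
open scoped ENNReal

namespace PercEnh

/-- Sites of the lattice (vertex set `ℤ²`). -/
abbrev Site : Type := ℤ × ℤ

/-- A configuration: the set of open sites. -/
abbrev Config : Type := Set Site

/-- Square-lattice (`ℤ²`-) adjacency: `‖x − y‖₁ = 1`. -/
def adjZ2 (x y : Site) : Prop := |x.1 - y.1| + |x.2 - y.2| = 1

/-- Matching (star) adjacency: `x ≠ y` and `‖x − y‖_∞ = 1`. -/
def adjStar (x y : Site) : Prop := x ≠ y ∧ max |x.1 - y.1| |x.2 - y.2| = 1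

/-- Euclidean norm of a site. -/
noncomputable def siteNorm (x : Site) : ℝ := Real.sqrt ((x.1 : ℝ) ^ 2 + (x.2 : ℝ) ^ 2)

/-- Sites in the closed Euclidean ball of radius `r` centred at the origin. -/
def siteBall (r : ℝ) : Set Site := {x | siteNorm x ≤ r}

/-- The shifted configuration `τ_x ω = {y − x : y ∈ ω}`. -/
def shiftConfig (x : Site) (ω : Config) : Config := {y | y + x ∈ ω}

/-- An enhancement function of (finite) range `R₀`: takes values in subsets of
`𝔹₀ = ℤ² ∩ B(R₀)` and depends only on the restriction of the configuration to `𝔹₀`. -/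
def IsEnhancement (R₀ : ℝ) (φ : Config → Config) : Prop :=
  0 ≤ R₀ ∧ (∀ ω, φ ω ⊆ siteBall R₀) ∧
    ∀ ω ω' : Config, ω ∩ siteBall R₀ = ω' ∩ siteBall R₀ → φ ω = φ ω'

/-- A monotonic enhancement function. -/
def Monotonic (φ : Config → Config) : Prop := ∀ ω ω' : Config, ω ⊆ ω' → φ ω ⊆ φ ω'

/-- The translate `φ_x(ω) = x + φ₀(τ_x ω)`. -/
def enhAt (φ : Config → Config) (x : Site) (ω : Config) : Config :=
  (fun z => z + x) '' φ (shiftConfig x ω)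

/-- The enhanced configuration `ω̂(ω, α) = ω ∪ ⋃_{x : α(x)=1} φ_x(ω)`. -/
def enhanced (φ : Config → Config) (ω : Config) (α : Site → Bool) : Config :=
  ω ∪ {y | ∃ x, α x = true ∧ y ∈ enhAt φ x ω}

/-- The fully (deterministically, with `s = 1`) enhanced configuration `ω̃`. -/
def fullyEnhanced (φ : Config → Config) (ω : Config) : Config :=
  ω ∪ {y | ∃ x, y ∈ enhAt φ x ω}

/-- `ω` contains a doubly-infinite self-repelling path (w.r.t. adjacency `adj`):
a two-sided sequence of distinct sites of `ω` in which exactly the consecutive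
pairs are adjacent. -/
def HasDISRPath (adj : Site → Site → Prop) (ω : Config) : Prop :=
  ∃ γ : ℤ → Site, Function.Injective γ ∧ (∀ i, γ i ∈ ω) ∧
    ∀ i j : ℤ, adj (γ i) (γ j) ↔ (j = i + 1 ∨ i = j + 1)

/-- The enhancement is essential: some configuration without a doubly-infinite
self-repelling path acquires one upon enhancement at the origin. -/
def Essential (adj : Site → Site → Prop) (φ : Config → Config) : Prop :=
  ∃ ω : Config, ¬ HasDISRPath adj ω ∧ HasDISRPath adj (ω ∪ φ ω)

/-- A (finite, nonempty) path w.r.t. adjacency `adj`: distinct sites,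
consecutive ones adjacent. -/
def IsPathOn (adj : Site → Site → Prop) (l : List Site) : Prop :=
  l ≠ [] ∧ l.Nodup ∧ l.Chain' adj

/-- `x` and `y` are joined by a path of sites of `ω`. -/
def ConnectedIn (adj : Site → Site → Prop) (ω : Config) (x y : Site) : Prop :=
  ∃ l : List Site, IsPathOn adj l ∧ (∀ z ∈ l, z ∈ ω) ∧
    l.head? = some x ∧ l.getLast? = some y

/-- `x` belongs to an infinite open cluster of `ω`. -/
def InInfiniteCluster (adj : Site → Site → Prop) (ω : Config) (x : Site) : Prop :=
  {y | ConnectedIn adj ω x y}.Infinite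

/-- `ω` contains an infinite open cluster. -/
def HasInfiniteCluster (adj : Site → Site → Prop) (ω : Config) : Prop :=
  ∃ x, InInfiniteCluster adj ω x

/-- The configuration corresponding to `η : Site → Bool`. -/
def toConfig (η : Site → Bool) : Config := {x | η x = true}

/-- A cylinder event. -/
def cylinder (F : Finset Site) (b : Site → Bool) : Set (Site → Bool) :=
  {η | ∀ x ∈ F, η x = b x}

/-- `μ` is the Bernoulli product measure with density `p` of open sites. -/
def IsBernoulli (p : ℝ) (μ : Measure (Site → Bool)) : Prop :=
  IsProbabilityMeasure μ ∧
    ∀ (F : Finset Site) (b : Site → Bool),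
      μ (cylinder F b) = ∏ x ∈ F, ENNReal.ofReal (if b x then p else 1 - p)

/-- The percolation probability `θ`: the probability that the origin lies in an
infinite open cluster. -/
noncomputable def theta (adj : Site → Site → Prop) (μ : Measure (Site → Bool)) : ℝ :=
  (μ {η | InInfiniteCluster adj (toConfig η) 0}).toReal

/-- The percolation probability of the enhanced process (`μ` the law of the
configuration, `ν` the law of the activation variables). -/
noncomputable def thetaEnh (adj : Site → Site → Prop) (φ : Config → Config)
    (μ ν : Measure (Site → Bool)) : ℝ :=
  ((μ.prod ν) {ηα | InInfiniteCluster adj (enhanced φ (toConfig ηα.1) ηα.2) 0}).toReal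

/-- The critical point `p_c = sup {p ∈ [0,1] : θ(p) = 0}` for the family `P`. -/
noncomputable def pcOf (adj : Site → Site → Prop) (P : ℝ → Measure (Site → Bool)) : ℝ :=
  sSup {p | p ∈ Icc (0:ℝ) 1 ∧ theta adj (P p) = 0}

/-- The connectivity function `τ_p(x)`. -/
noncomputable def tau (adj : Site → Site → Prop) (μ : Measure (Site → Bool)) (x : Site) : ℝ :=
  (μ {η | ConnectedIn adj (toConfig η) 0 x}).toReal

/-- The connectivity function `τ_{p,s}(x)` of the enhanced process. -/
noncomputable def tauEnh (adj : Site → Site → Prop) (φ : Config → Config)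
    (μ ν : Measure (Site → Bool)) (x : Site) : ℝ :=
  ((μ.prod ν) {ηα | ConnectedIn adj (enhanced φ (toConfig ηα.1) ηα.2) 0 x}).toReal

/-- The mean cluster size `χ(p) = E_p‖C‖ = ∑_x τ_p(x)`. -/
noncomputable def chi (adj : Site → Site → Prop) (μ : Measure (Site → Bool)) : ℝ≥0∞ :=
  ∑' x : Site, μ {η | ConnectedIn adj (toConfig η) 0 x}

/-- The mean cluster size of the enhanced process. -/
noncomputable def chiEnh (adj : Site → Site → Prop) (φ : Config → Config)
    (μ ν : Measure (Site → Bool)) : ℝ≥0∞ :=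
  ∑' x : Site, (μ.prod ν) {ηα | ConnectedIn adj (enhanced φ (toConfig ηα.1) ηα.2) 0 x}

/-- Triangular-lattice adjacency, realized on the vertex set `ℤ²`:
`x ~ y` iff `x − y ∈ {±(1,0), ±(0,1), ±(1,1)}`. -/
def adjT (x y : Site) : Prop :=
  x - y = (1, 0) ∨ x - y = (-1, 0) ∨ x - y = (0, 1) ∨ x - y = (0, -1) ∨
    x - y = (1, 1) ∨ x - y = (-1, -1)

/-! ### Lattice geometry -/

lemma adjT_iff (x y : Site) : adjT x y ↔
    (x.1 - y.1 = 1 ∧ x.2 - y.2 = 0) ∨ (x.1 - y.1 = -1 ∧ x.2 - y.2 = 0) ∨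
    (x.1 - y.1 = 0 ∧ x.2 - y.2 = 1) ∨ (x.1 - y.1 = 0 ∧ x.2 - y.2 = -1) ∨
    (x.1 - y.1 = 1 ∧ x.2 - y.2 = 1) ∨ (x.1 - y.1 = -1 ∧ x.2 - y.2 = -1) := by
  simp only [adjT, Prod.ext_iff, Prod.fst_sub, Prod.snd_sub]

lemma adjT_comm (x y : Site) : adjT x y ↔ adjT y x := by
  rw [adjT_iff, adjT_iff]; omega

lemma not_adjT_self (x : Site) : ¬ adjT x x := by
  rw [adjT_iff]; omega

lemma adjT_add_right (x y z : Site) : adjT (x + z) (y + z) ↔ adjT x y := by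
  simp only [adjT_iff, Prod.fst_add, Prod.snd_add]; omega

/-- The graph norm of the triangular lattice; its balls are hexagons. -/
def hexNorm (x : Site) : ℤ :=
  max (max (max x.1 (-x.1)) (max x.2 (-x.2))) (max (x.1 - x.2) (x.2 - x.1))

lemma hexNorm_le_of_adjT {x y : Site} (h : adjT x y) : hexNorm y ≤ hexNorm x + 1 := by
  rw [adjT_iff] at h; unfold hexNorm; omega

lemma hexNorm_le_iff (x : Site) (n : ℤ) : hexNorm x ≤ n ↔
    -n ≤ x.1 ∧ x.1 ≤ n ∧ -n ≤ x.2 ∧ x.2 ≤ n ∧ x.1 - x.2 ≤ n ∧ x.2 - x.1 ≤ n := by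
  unfold hexNorm; omega

lemma hexNorm_spec (x : Site) :
    (-hexNorm x ≤ x.1 ∧ x.1 ≤ hexNorm x ∧ -hexNorm x ≤ x.2 ∧ x.2 ≤ hexNorm x ∧
      x.1 - x.2 ≤ hexNorm x ∧ x.2 - x.1 ≤ hexNorm x) ∧
    (x.1 = hexNorm x ∨ x.1 = -hexNorm x ∨ x.2 = hexNorm x ∨ x.2 = -hexNorm x ∨
      x.1 - x.2 = hexNorm x ∨ x.2 - x.1 = hexNorm x) := by
  refine ⟨(hexNorm_le_iff x _).1 le_rfl, ?_⟩
  unfold hexNorm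
  omega

lemma hexNorm_neg (x : Site) : hexNorm (-x) = hexNorm x := by
  simp only [hexNorm, Prod.fst_neg, Prod.snd_neg]; omega

lemma hexNorm_add_le (x y : Site) : hexNorm (x + y) ≤ hexNorm x + hexNorm y := by
  have hx := (hexNorm_le_iff x _).1 le_rfl
  have hy := (hexNorm_le_iff y _).1 le_rfl
  rw [hexNorm_le_iff, Prod.fst_add, Prod.snd_add]
  omega

lemma finite_hexNorm_le (n : ℤ) : {x : Site | hexNorm x ≤ n}.Finite := by
  apply ((Set.finite_Icc (-n) n).prod (Set.finite_Icc (-n) n)).subset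
  intro x hx
  have := (hexNorm_le_iff x n).1 hx
  simp only [Set.mem_prod, Set.mem_Icc]
  omega

lemma exists_hexNorm_le_of_mem_siteBall (R : ℝ) :
    ∃ n : ℤ, 0 ≤ n ∧ ∀ x ∈ siteBall R, hexNorm x ≤ n := by
  refine ⟨2 * ⌈|R|⌉, by positivity, fun x hx => ?_⟩
  have hx' : Real.sqrt ((x.1 : ℝ) ^ 2 + (x.2 : ℝ) ^ 2) ≤ |R| := le_trans hx (le_abs_self R)
  have key : ∀ a : ℤ, (a : ℝ) ^ 2 ≤ (x.1 : ℝ) ^ 2 + (x.2 : ℝ) ^ 2 →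
      -⌈|R|⌉ ≤ a ∧ a ≤ ⌈|R|⌉ := by
    intro a ha
    have h1 : |(a : ℝ)| ≤ |R| :=
      le_trans (by rw [← Real.sqrt_sq_eq_abs]; exact Real.sqrt_le_sqrt ha) hx'
    have h2 : |(a : ℝ)| ≤ ⌈|R|⌉ := h1.trans (Int.le_ceil _)
    have h3 := abs_le.1 h2
    exact ⟨by exact_mod_cast h3.1, by exact_mod_cast h3.2⟩
  have h1 := key x.1 (by nlinarith [sq_nonneg (x.2 : ℝ)])
  have h2 := key x.2 (by nlinarith [sq_nonneg (x.1 : ℝ)])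
  rw [hexNorm_le_iff]
  omega

/-- The direction in which a site is pushed outwards, constant on each of six half-open cones. -/
def outDir (a : Site) : Site :=
  if 0 ≤ a.2 ∧ a.2 < a.1 then (1, 0)
  else if 0 < a.1 ∧ a.1 ≤ a.2 then (1, 1)
  else if 0 < a.2 ∧ a.1 ≤ 0 then (0, 1)
  else if a.2 ≤ 0 ∧ a.1 < a.2 then (-1, 0)
  else if a.1 < 0 ∧ a.2 ≤ a.1 then (-1, -1)
  else (0, -1)

/-- The straight ray going outwards from `a`. -/
def ray (a : Site) (t : ℕ) : Site := (a.1 + t * (outDir a).1, a.2 + t * (outDir a).2)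

lemma ray_cases (a : Site) (t : ℕ) :
    (0 ≤ a.2 ∧ a.2 < a.1 ∧ hexNorm a = a.1 ∧ (ray a t).1 = a.1 + t ∧ (ray a t).2 = a.2) ∨
    (0 < a.1 ∧ a.1 ≤ a.2 ∧ hexNorm a = a.2 ∧ (ray a t).1 = a.1 + t ∧ (ray a t).2 = a.2 + t) ∨
    (0 < a.2 ∧ a.1 ≤ 0 ∧ hexNorm a = a.2 - a.1 ∧ (ray a t).1 = a.1 ∧ (ray a t).2 = a.2 + t) ∨
    (a.2 ≤ 0 ∧ a.1 < a.2 ∧ hexNorm a = -a.1 ∧ (ray a t).1 = a.1 - t ∧ (ray a t).2 = a.2) ∨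
    (a.1 < 0 ∧ a.2 ≤ a.1 ∧ hexNorm a = -a.2 ∧ (ray a t).1 = a.1 - t ∧ (ray a t).2 = a.2 - t) ∨
    ((a.2 < 0 ∨ a.1 = 0) ∧ (a.2 ≤ 0 ∧ 0 ≤ a.1) ∧ hexNorm a = a.1 - a.2 ∧
      (ray a t).1 = a.1 ∧ (ray a t).2 = a.2 - t) := by
  have hs := hexNorm_spec a
  generalize hexNorm a = n at hs ⊢
  by_cases h1 : 0 ≤ a.2 ∧ a.2 < a.1
  · have hd : outDir a = (1, 0) := by
      unfold outDir
      rw [if_pos h1]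
    refine Or.inl ⟨h1.1, h1.2, by omega, ?_, ?_⟩ <;>
      simp [ray, hd]
  by_cases h2 : 0 < a.1 ∧ a.1 ≤ a.2
  · have hd : outDir a = (1, 1) := by
      unfold outDir
      rw [if_neg h1, if_pos h2]
    refine Or.inr <| Or.inl ⟨h2.1, h2.2, by omega, ?_, ?_⟩ <;>
      simp [ray, hd]
  by_cases h3 : 0 < a.2 ∧ a.1 ≤ 0
  · have hd : outDir a = (0, 1) := by
      unfold outDir
      rw [if_neg h1, if_neg h2, if_pos h3]
    refine Or.inr <| Or.inr <| Or.inl ⟨h3.1, h3.2, by omega, ?_, ?_⟩ <;>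
      simp [ray, hd]
  by_cases h4 : a.2 ≤ 0 ∧ a.1 < a.2
  · have hd : outDir a = (-1, 0) := by
      unfold outDir
      rw [if_neg h1, if_neg h2, if_neg h3, if_pos h4]
    refine Or.inr <| Or.inr <| Or.inr <| Or.inl ⟨h4.1, h4.2, by omega, ?_, ?_⟩ <;>
      simp [ray, hd, sub_eq_add_neg]
  by_cases h5 : a.1 < 0 ∧ a.2 ≤ a.1
  · have hd : outDir a = (-1, -1) := by
      unfold outDir
      rw [if_neg h1, if_neg h2, if_neg h3, if_neg h4, if_pos h5]
    refine Or.inr <| Or.inr <| Or.inr <| Or.inr <| Or.inl ⟨h5.1, h5.2, by omega, ?_, ?_⟩ <;>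
      simp [ray, hd, sub_eq_add_neg]
  have hd : outDir a = (0, -1) := by
    unfold outDir
    rw [if_neg h1, if_neg h2, if_neg h3, if_neg h4, if_neg h5]
  have h6 : (a.2 < 0 ∨ a.1 = 0) ∧ a.2 ≤ 0 ∧ 0 ≤ a.1 := by omega
  refine Or.inr <| Or.inr <| Or.inr <| Or.inr <| Or.inr ⟨h6.1, h6.2, by omega, ?_, ?_⟩ <;>
    simp [ray, hd, sub_eq_add_neg]

@[simp] lemma ray_zero (a : Site) : ray a 0 = a := by
  simp [ray]

lemma hexNorm_ray (a : Site) (t : ℕ) : hexNorm (ray a t) = hexNorm a + t := by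
  have h := ray_cases a t
  have hs := hexNorm_spec (ray a t)
  generalize hexNorm (ray a t) = m at hs
  rcases h with h | h | h | h | h | h <;> omega

lemma adjT_ray_ray (a : Site) (s t : ℕ) :
    adjT (ray a s) (ray a t) ↔ (t = s + 1 ∨ s = t + 1) := by
  have h1 := ray_cases a t
  have h2 := ray_cases a s
  rw [adjT_iff]
  rcases h1 with h1 | h1 | h1 | h1 | h1 | h1 <;> rcases h2 with h2 | h2 | h2 | h2 | h2 | h2 <;>
    omega

lemma not_adjT_ray_ray {a b : Site} (hab : hexNorm a = hexNorm b) (ha : 0 < hexNorm a)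
    (hne : a ≠ b) (hadj : ¬ adjT a b) (s t : ℕ) :
    ¬ adjT (ray a s) (ray b t) := by
  have h1 := ray_cases a s
  have h2 := ray_cases b t
  rw [Ne, Prod.ext_iff] at hne
  rw [adjT_iff] at hadj ⊢
  rcases h1 with h1 | h1 | h1 | h1 | h1 | h1 <;> rcases h2 with h2 | h2 | h2 | h2 | h2 | h2 <;>
    omega

/-- The triangular lattice restricted to the open sites. -/
def openGraph (ω : Config) : SimpleGraph Site where
  Adj a b := adjT a b ∧ a ∈ ω ∧ b ∈ ω
  symm := ⟨fun _ _ h => ⟨(adjT_comm _ _).1 h.1, h.2.2, h.2.1⟩⟩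
  loopless := ⟨fun a h => not_adjT_self a h.1⟩

lemma openGraph_mono {ω ω' : Config} (h : ω ⊆ ω') : openGraph ω ≤ openGraph ω' :=
  fun _ _ hab => ⟨hab.1, h hab.2.1, h hab.2.2⟩

lemma mem_of_mem_support {ω : Config} {x y : Site} (p : (openGraph ω).Walk x y) (hx : x ∈ ω) :
    ∀ z ∈ p.support, z ∈ ω := by
  induction p with
  | nil => simpa using hx
  | cons h p ih =>
    intro z hz
    rw [SimpleGraph.Walk.support_cons, List.mem_cons] at hz
    rcases hz with rfl | hz
    · exact hx
    · exact ih h.2.2 z hz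

lemma Reachable.mem {ω : Config} {x y : Site} (h : (openGraph ω).Reachable x y) (hx : x ∈ ω) :
    y ∈ ω := by
  obtain ⟨p⟩ := h
  exact mem_of_mem_support p hx y p.end_mem_support

lemma reachable_of_list {ω : Config} {y : Site} : ∀ (l : List Site) (x : Site),
    (x :: l).IsChain adjT → (∀ z ∈ x :: l, z ∈ ω) → (x :: l).getLast? = some y →
    (openGraph ω).Reachable x y
  | [], x, _, _, hl => by
    simp only [List.getLast?_singleton, Option.some.injEq] at hl
    rw [hl]
  | w :: l, x, hc, hm, hl => by
    rw [List.isChain_cons_cons] at hc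
    have h1 : (openGraph ω).Adj x w := ⟨hc.1, hm x (by simp), hm w (by simp)⟩
    exact h1.reachable.trans (reachable_of_list l w hc.2
      (fun z hz => hm z (List.mem_cons_of_mem _ hz)) (by rwa [List.getLast?_cons_cons] at hl))

lemma connectedIn_iff (ω : Config) (x y : Site) :
    ConnectedIn adjT ω x y ↔ x ∈ ω ∧ (openGraph ω).Reachable x y := by
  classical
  constructor
  · rintro ⟨l, ⟨hne, -, hc⟩, hm, hh, hl⟩
    obtain ⟨l', rfl⟩ := List.head?_eq_some_iff.1 hh
    exact ⟨hm x (by simp), reachable_of_list l' x hc hm hl⟩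
  · rintro ⟨hx, ⟨p⟩⟩
    refine ⟨p.toPath.1.support, ⟨by simp, p.toPath.2.support_nodup, ?_⟩,
      mem_of_mem_support _ hx, ?_, ?_⟩
    · exact (SimpleGraph.Walk.isChain_adj_support _).imp fun a b h => h.1
    · rw [List.head?_eq_some_head (by simp)]; simp
    · rw [List.getLast?_eq_some_getLast (by simp)]; simp

lemma ConnectedIn.mono {ω ω' : Config} (h : ω ⊆ ω') {x y : Site} (hc : ConnectedIn adjT ω x y) :
    ConnectedIn adjT ω' x y := by
  rw [connectedIn_iff] at hc ⊢
  exact ⟨h hc.1, hc.2.mono (openGraph_mono h)⟩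

lemma InInfiniteCluster.mono {ω ω' : Config} (h : ω ⊆ ω') {x : Site}
    (hc : InInfiniteCluster adjT ω x) : InInfiniteCluster adjT ω' x :=
  Set.Infinite.mono (fun _ hy => ConnectedIn.mono h hy) hc

lemma hexNorm_sub_le_length {ω : Config} {x y : Site} (p : (openGraph ω).Walk x y) :
    hexNorm (y - x) ≤ p.length := by
  induction p with
  | nil => simp [hexNorm]
  | @cons u v w h p ih =>
    have h1 := h.1
    rw [adjT_iff] at h1
    rw [hexNorm_le_iff] at ih ⊢
    simp only [Prod.fst_sub, Prod.snd_sub, SimpleGraph.Walk.length_cons] at ih ⊢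
    push_cast
    omega

/-- A long connection contains an open path of any prescribed shorter length. -/
lemma exists_path_of_le_hexNorm {ω : Config} {x y : Site} (hx : x ∈ ω)
    (h : (openGraph ω).Reachable x y) {n : ℕ} (hn : (n : ℤ) ≤ hexNorm (y - x)) :
    ∃ l : List Site, l.length = n ∧ (x :: l).Nodup ∧ (x :: l).IsChain adjT ∧
      ∀ z ∈ x :: l, z ∈ ω := by
  classical
  obtain ⟨p⟩ := h
  have hlen := hexNorm_sub_le_length p.toPath.1
  have hm := mem_of_mem_support p.toPath.1 hx
  have hnd := p.toPath.2.support_nodup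
  have hc := (SimpleGraph.Walk.isChain_adj_support p.toPath.1).imp
    (fun (a b : Site) (h : (openGraph ω).Adj a b) => h.1)
  have hl := SimpleGraph.Walk.length_support p.toPath.1
  rw [← SimpleGraph.Walk.cons_tail_support] at hm hnd hc hl
  refine ⟨p.toPath.1.support.tail.take n, ?_, ?_, ?_, ?_⟩
  · rw [List.length_take]
    simp only [List.length_cons] at hl
    omega
  · have := hnd.sublist (List.take_sublist (n + 1) _)
    rwa [List.take_succ_cons] at this
  · have := hc.take (n + 1)
    rwa [List.take_succ_cons] at this
  · intro z hz
    rw [← List.take_succ_cons] at hz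
    exact hm z (List.mem_of_mem_take hz)

/-! ### Nonessential enhancements preserve connections locally -/

lemma exists_eq_of_step {f : ℕ → ℤ} {m : ℤ} (h0 : f 0 < m) (hstep : ∀ n, f (n + 1) ≤ f n + 1)
    (hex : ∃ n, m ≤ f n) : ∃ n, 0 < n ∧ f n = m := by
  classical
  have h1 := Nat.find_spec hex
  have h2 : 0 < Nat.find hex := by
    rcases Nat.eq_zero_or_pos (Nat.find hex) with h | h
    · rw [h] at h1; omega
    · exact h
  refine ⟨_, h2, ?_⟩
  have h3 := Nat.find_min hex (m := Nat.find hex - 1) (by omega)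
  have h4 := hstep (Nat.find hex - 1)
  rw [Nat.sub_add_cancel h2] at h4
  omega

lemma exists_hexNorm_eq {f : ℕ → Site} (hinj : Function.Injective f)
    (hadj : ∀ n, adjT (f n) (f (n + 1))) {m : ℤ} (h0 : hexNorm (f 0) < m) :
    ∃ n, 0 < n ∧ hexNorm (f n) = m := by
  apply exists_eq_of_step (f := fun n => hexNorm (f n)) h0
  · intro n
    exact hexNorm_le_of_adjT (hadj n)
  · by_contra hcon
    push Not at hcon
    exact Set.infinite_of_injective_forall_mem hinj (fun n => (hcon n).le) (finite_hexNorm_le m)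

/-- A doubly-infinite path cannot live on the union of a finite hexagon and a single ray. -/
lemma false_of_path_in_ray {γ : ℤ → Site} (hinj : Function.Injective γ)
    (hadj : ∀ i, adjT (γ i) (γ (i + 1))) {n : ℤ} {a : Site}
    (hγ : ∀ i, hexNorm (γ i) ≤ n ∨ ∃ t, γ i = ray a t) : False := by
  set m := max (hexNorm (γ 0)) n + 1 with hm
  obtain ⟨i, hi, him⟩ := exists_hexNorm_eq (f := fun k : ℕ => γ k) (m := m)
    (fun x y h => by simpa using hinj h) (fun k => by simpa using hadj k)
    (by simp only [Nat.cast_zero]; omega)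
  obtain ⟨j, hj, hjm⟩ := exists_hexNorm_eq (f := fun k : ℕ => γ (-k)) (m := m)
    (fun x y h => by simpa using hinj h)
    (fun k => by
      have := hadj (-(k + 1 : ℕ))
      rw [adjT_comm]
      convert this using 2
      push_cast; ring)
    (by simp only [Nat.cast_zero, neg_zero]; omega)
  have hu : ∀ k, hexNorm (γ k) = m → γ k = ray a (m - hexNorm a).toNat := by
    intro k hk
    rcases hγ k with h | ⟨t, ht⟩
    · omega
    · rw [ht, hexNorm_ray] at hk
      rw [ht]
      congr 1
      omega
  have := hinj ((hu _ him).trans (hu _ hjm).symm)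
  omega

/-- If `r` moves sites at most along connections, then it maps connections to connections. -/
lemma reachable_retract {ω ω' : Config} (r : Site → Site)
    (hr : ∀ x y, (openGraph ω).Adj x y → (openGraph ω').Reachable (r x) (r y)) {x y : Site}
    (h : (openGraph ω).Reachable x y) : (openGraph ω').Reachable (r x) (r y) := by
  obtain ⟨p⟩ := h
  induction p with
  | nil => exact SimpleGraph.Reachable.refl _
  | cons h p ih => exact (hr _ _ h).trans ih

section Local

variable {n : ℤ} {a b : Site} {ω : Config}

/-- The sites of `ω` in the hexagon of radius `n`. -/
def inHex (n : ℤ) (ω : Config) : Config := {x | x ∈ ω ∧ hexNorm x ≤ n}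

/-- A configuration inside a hexagon with two rays attached. -/
def withRays (n : ℤ) (ω : Config) (a b : Site) : Config :=
  inHex n ω ∪ (Set.range (ray a) ∪ Set.range (ray b))

/-- Maps both rays to their starting points. -/
noncomputable def rayRetract (n : ℤ) (a b x : Site) : Site :=
  open Classical in
  if hexNorm x ≤ n then x else if ∃ t, x = ray a t then a else b

lemma adjT_hex_ray {x : Site} (hx : hexNorm x ≤ n) (ha : hexNorm a = n + 1) {t : ℕ}
    (h : adjT x (ray a t)) : t = 0 := by
  have := hexNorm_le_of_adjT h
  rw [hexNorm_ray] at this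
  omega

lemma ray_ne_ray (hn : 0 ≤ n) (ha : hexNorm a = n + 1) (hb : hexNorm b = n + 1)
    (hne : a ≠ b) (hadj : ¬ adjT a b) (s t : ℕ) : ray a s ≠ ray b t := by
  intro h
  have h1 := not_adjT_ray_ray (ha.trans hb.symm) (by omega) hne hadj (s + 1) t
  rw [← h, adjT_ray_ray] at h1
  omega

lemma rayRetract_of_le {x : Site} (hx : hexNorm x ≤ n) : rayRetract n a b x = x := if_pos hx

lemma rayRetract_left (ha : hexNorm a = n + 1) (t : ℕ) : rayRetract n a b (ray a t) = a := by
  unfold rayRetract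
  rw [if_neg (by rw [hexNorm_ray]; omega), if_pos ⟨t, rfl⟩]

lemma rayRetract_right (hn : 0 ≤ n) (ha : hexNorm a = n + 1) (hb : hexNorm b = n + 1)
    (hne : a ≠ b) (hadj : ¬ adjT a b) (t : ℕ) : rayRetract n a b (ray b t) = b := by
  unfold rayRetract
  rw [if_neg (by rw [hexNorm_ray]; omega), if_neg]
  rintro ⟨s, hs⟩
  exact ray_ne_ray hn ha hb hne hadj s t hs.symm

lemma reachable_rayRetract (hn : 0 ≤ n) (ha : hexNorm a = n + 1) (hb : hexNorm b = n + 1)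
    (hne : a ≠ b) (hadj : ¬ adjT a b) {x y : Site}
    (h : (openGraph (withRays n ω a b)).Reachable x y) :
    (openGraph ({a, b} ∪ inHex n ω)).Reachable (rayRetract n a b x) (rayRetract n a b y) := by
  refine reachable_retract _ ?_ h
  have key : ∀ x y, adjT x y → x ∈ inHex n ω → y ∈ Set.range (ray a) ∪ Set.range (ray b) →
      (openGraph ({a, b} ∪ inHex n ω)).Reachable (rayRetract n a b x) (rayRetract n a b y) := by
    rintro x y hxy hx (⟨t, rfl⟩ | ⟨t, rfl⟩)
    · have := adjT_hex_ray hx.2 ha hxy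
      subst this
      rw [rayRetract_of_le hx.2, rayRetract_left ha]
      apply SimpleGraph.Adj.reachable
      exact ⟨by simpa using hxy, Or.inr hx, by simp⟩
    · have := adjT_hex_ray hx.2 hb hxy
      subst this
      rw [rayRetract_of_le hx.2, rayRetract_right hn ha hb hne hadj]
      apply SimpleGraph.Adj.reachable
      exact ⟨by simpa using hxy, Or.inr hx, by simp⟩
  rintro x y ⟨hxy, hx | hx, hy | hy⟩
  · rw [rayRetract_of_le hx.2, rayRetract_of_le hy.2]
    apply SimpleGraph.Adj.reachable
    exact ⟨hxy, Or.inr hx, Or.inr hy⟩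
  · exact key x y hxy hx hy
  · exact (key y x ((adjT_comm _ _).1 hxy) hy hx).symm
  · rcases hx with ⟨s, rfl⟩ | ⟨s, rfl⟩ <;> rcases hy with ⟨t, rfl⟩ | ⟨t, rfl⟩
    · rw [rayRetract_left ha, rayRetract_left ha]
    · exact absurd hxy (not_adjT_ray_ray (ha.trans hb.symm) (by omega) hne hadj s t)
    · exact absurd ((adjT_comm _ _).1 hxy)
        (not_adjT_ray_ray (ha.trans hb.symm) (by omega) hne hadj t s)
    · rw [rayRetract_right hn ha hb hne hadj, rayRetract_right hn ha hb hne hadj]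

lemma not_hasDISRPath_withRays (hn : 0 ≤ n) (ha : hexNorm a = n + 1) (hb : hexNorm b = n + 1)
    (hne : a ≠ b) (hadj : ¬ adjT a b)
    (hcon : ¬ (openGraph ({a, b} ∪ inHex n ω)).Reachable a b) :
    ¬ HasDISRPath adjT (withRays n ω a b) := by
  rintro ⟨γ, hinj, hmem, hγ⟩
  have hstep : ∀ i, adjT (γ i) (γ (i + 1)) := fun i => (hγ _ _).2 (Or.inl rfl)
  have hreach0 : ∀ i : ℤ, (openGraph (withRays n ω a b)).Reachable (γ 0) (γ i) := by
    intro i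
    induction i using Int.induction_on with
    | zero => exact SimpleGraph.Reachable.refl _
    | succ k ih =>
      exact ih.trans (SimpleGraph.Adj.reachable ⟨hstep k, hmem _, hmem _⟩)
    | pred k ih =>
      refine ih.trans (SimpleGraph.Adj.reachable (SimpleGraph.Adj.symm ⟨?_, hmem _, hmem _⟩))
      simpa using hstep (-k - 1)
  have hreach : ∀ i j : ℤ, (openGraph (withRays n ω a b)).Reachable (γ i) (γ j) :=
    fun i j => (hreach0 i).symm.trans (hreach0 j)
  by_cases h : ∃ i t, γ i = ray a t
  · obtain ⟨i, t, hi⟩ := h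
    refine false_of_path_in_ray hinj hstep (n := n) (a := a) fun j => ?_
    rcases hmem j with h | ⟨s, hs⟩ | ⟨s, hs⟩
    · exact Or.inl h.2
    · exact Or.inr ⟨s, hs.symm⟩
    · have := reachable_rayRetract hn ha hb hne hadj (hreach i j)
      rw [hi, ← hs, rayRetract_left ha, rayRetract_right hn ha hb hne hadj] at this
      exact absurd this hcon
  · refine false_of_path_in_ray hinj hstep (n := n) (a := b) fun j => ?_
    rcases hmem j with h' | ⟨s, hs⟩ | ⟨s, hs⟩
    · exact Or.inl h'.2
    · exact absurd ⟨j, s, hs.symm⟩ h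
    · exact Or.inr ⟨s, hs.symm⟩

lemma injective_of_adjT_iff {γ : ℤ → Site}
    (h : ∀ i j : ℤ, adjT (γ i) (γ j) ↔ (j = i + 1 ∨ i = j + 1)) : Function.Injective γ := by
  intro i j hij
  have h1 := h j (i + 1)
  have h2 := h j (i - 1)
  rw [← hij, h] at h1 h2
  omega

/-- A connection between two boundary sites of a hexagon extends along rays to a
doubly-infinite self-repelling path. -/
lemma hasDISRPath_withRays (hn : 0 ≤ n) (ha : hexNorm a = n + 1) (hb : hexNorm b = n + 1)
    (hne : a ≠ b) (hadj : ¬ adjT a b)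
    (hcon : (openGraph ({a, b} ∪ inHex n ω)).Reachable a b) :
    HasDISRPath adjT (withRays n ω a b) := by
  obtain ⟨p, hp, hlen⟩ := hcon.exists_path_of_dist
  set L := p.length with hL
  have hmem : ∀ i, p.getVert i ∈ ({a, b} ∪ inHex n ω : Set Site) := fun i =>
    mem_of_mem_support p (by simp) _ (p.getVert_mem_support i)
  have hinjp : ∀ i j, i ≤ L → j ≤ L → p.getVert i = p.getVert j → i = j := fun i j hi hj h =>
    hp.getVert_injOn hi hj h
  have hinside : ∀ i, 0 < i → i < L → p.getVert i ∈ inHex n ω := by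
    intro i h0 h1
    rcases hmem i with (h | h) | h
    · have := hinjp i 0 (by omega) (by omega) (by simpa using h)
      omega
    · have := hinjp i L (by omega) le_rfl (by simpa [hL] using h)
      omega
    · exact h
  have hshort : ∀ i j, i < j → j ≤ L → adjT (p.getVert i) (p.getVert j) → j = i + 1 := by
    intro i j hij hj had
    have hA : (openGraph ({a, b} ∪ inHex n ω)).Adj (p.getVert i) (p.getVert j) :=
      ⟨had, hmem i, hmem j⟩
    have h1 := SimpleGraph.dist_le ((p.take i).append (SimpleGraph.Walk.cons hA (p.drop j)))
    rw [SimpleGraph.Walk.length_append, SimpleGraph.Walk.length_cons, SimpleGraph.Walk.take_length,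
      SimpleGraph.Walk.drop_length, ← hlen] at h1
    omega
  have hadjp : ∀ i, i < L → adjT (p.getVert i) (p.getVert (i + 1)) := fun i hi =>
    (p.adj_getVert_succ hi).1
  set γ : ℤ → Site := fun i => if i ≤ 0 then ray a (-i).toNat else
    if i < L then p.getVert i.toNat else ray b (i - L).toNat with hγ
  have hLpos : 0 < L := by
    rcases Nat.eq_zero_or_pos L with h | h
    · exact absurd (SimpleGraph.Walk.eq_of_length_eq_zero h) hne
    · exact h
  have hγ1 : ∀ i : ℤ, i ≤ 0 → γ i = ray a (-i).toNat := fun i hi => if_pos hi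
  have hγ2 : ∀ i : ℤ, 0 ≤ i → i ≤ L → γ i = p.getVert i.toNat := by
    intro i h0 h1
    rcases eq_or_lt_of_le h0 with rfl | h0
    · rw [hγ1 0 le_rfl]; simp
    · simp only [hγ]
      rcases eq_or_lt_of_le h1 with rfl | h1
      · rw [if_neg (by omega), if_neg (by omega)]
        simp [hL]
      · rw [if_neg (by omega), if_pos h1]
  have hγ3 : ∀ i : ℤ, (L : ℤ) ≤ i → γ i = ray b (i - L).toNat := by
    intro i hi
    simp only [hγ]
    rw [if_neg (by omega), if_neg (by omega)]
  have hlt : ∀ i j : ℤ, i < j → (adjT (γ i) (γ j) ↔ j = i + 1) := by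
    intro i j hij
    rcases le_or_gt j 0 with hj | hj
    · rw [hγ1 i (by omega), hγ1 j hj, adjT_ray_ray]
      omega
    rcases le_or_gt (L : ℤ) i with hi | hi
    · rw [hγ3 i hi, hγ3 j (by omega), adjT_ray_ray]
      omega
    rcases lt_or_ge i 0 with hi0 | hi0
    · refine iff_of_false ?_ (by omega)
      rw [hγ1 i hi0.le]
      rcases le_or_gt (L : ℤ) j with hjL | hjL
      · rw [hγ3 j hjL]
        exact not_adjT_ray_ray (ha.trans hb.symm) (by omega) hne hadj _ _
      · rw [hγ2 j hj.le hjL.le, adjT_comm]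
        intro h
        have := adjT_hex_ray (hinside j.toNat (by omega) (by omega)).2 ha h
        omega
    · rw [hγ2 i hi0 hi.le]
      rcases le_or_gt j (L : ℤ) with hjL | hjL
      · rw [hγ2 j hj.le hjL]
        constructor
        · intro h
          have := hshort i.toNat j.toNat (by omega) (by omega) h
          omega
        · rintro rfl
          have := hadjp i.toNat (by omega)
          rwa [show (i + 1).toNat = i.toNat + 1 by omega]
      · refine iff_of_false ?_ (by omega)
        rw [hγ3 j hjL.le]
        rcases eq_or_lt_of_le hi0 with rfl | hi0
        · have := not_adjT_ray_ray (ha.trans hb.symm) (by omega) hne hadj 0 (j - L).toNat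
          simpa using this
        · intro h
          have := adjT_hex_ray (hinside i.toNat (by omega) (by omega)).2 hb h
          omega
  have hiff : ∀ i j : ℤ, adjT (γ i) (γ j) ↔ (j = i + 1 ∨ i = j + 1) := by
    intro i j
    rcases lt_trichotomy i j with h | rfl | h
    · rw [hlt i j h]; omega
    · exact iff_of_false (not_adjT_self _) (by omega)
    · rw [adjT_comm, hlt j i h]; omega
  refine ⟨γ, injective_of_adjT_iff hiff, fun i => ?_, hiff⟩
  rcases le_or_gt i 0 with hi | hi
  · rw [hγ1 i hi]; exact Or.inr (Or.inl ⟨_, rfl⟩)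
  rcases le_or_gt (L : ℤ) i with hi' | hi'
  · rw [hγ3 i hi']; exact Or.inr (Or.inr ⟨_, rfl⟩)
  · rw [hγ2 i hi.le hi'.le]; exact Or.inl (hinside _ (by omega) (by omega))

end Local

/-! ### Connections in the enhanced configuration -/

section Enhancement

variable {R₀ : ℝ} {φ : Config → Config} {n : ℤ}

lemma reachable_hex_of_enh (hφ : IsEnhancement R₀ φ) (hness : ¬ Essential adjT φ) (hn : 0 ≤ n)
    (hR : ∀ x ∈ siteBall R₀, hexNorm x ≤ n) {ω : Config} {a b : Site}
    (ha : hexNorm a = n + 1) (hb : hexNorm b = n + 1)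
    (h : (openGraph ({a, b} ∪ inHex n (ω ∪ φ ω))).Reachable a b) :
    (openGraph ({a, b} ∪ inHex n ω)).Reachable a b := by
  by_cases hne : a = b
  · rw [hne]
  by_cases hadj : adjT a b
  · exact SimpleGraph.Adj.reachable ⟨hadj, by simp, by simp⟩
  by_contra hcon
  refine hness ⟨withRays n ω a b, not_hasDISRPath_withRays hn ha hb hne hadj hcon, ?_⟩
  have h1 : φ (withRays n ω a b) = φ ω := by
    apply hφ.2.2
    ext x
    constructor
    · rintro ⟨hx | ⟨t, rfl⟩ | ⟨t, rfl⟩, hx'⟩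
      · exact ⟨hx.1, hx'⟩
      · have := hR _ hx'
        rw [hexNorm_ray] at this; omega
      · have := hR _ hx'
        rw [hexNorm_ray] at this; omega
    · rintro ⟨hx, hx'⟩
      exact ⟨Or.inl ⟨hx, hR x hx'⟩, hx'⟩
  have h2 : withRays n ω a b ∪ φ (withRays n ω a b) = withRays n (ω ∪ φ ω) a b := by
    rw [h1]
    have : inHex n (ω ∪ φ ω) = inHex n ω ∪ φ ω := by
      ext x
      constructor
      · rintro ⟨hx | hx, hx'⟩
        · exact Or.inl ⟨hx, hx'⟩
        · exact Or.inr hx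
      · rintro (hx | hx)
        · exact ⟨Or.inl hx.1, hx.2⟩
        · exact ⟨Or.inr hx, hR x (hφ.2.1 ω hx)⟩
    unfold withRays
    rw [this, Set.union_right_comm]
  rw [h2]
  exact hasDISRPath_withRays hn ha hb hne hadj h

/-- A nonessential enhancement at the origin does not connect sites outside its hexagon. -/
lemma reachable_of_enh_zero (hφ : IsEnhancement R₀ φ) (hness : ¬ Essential adjT φ) (hn : 0 ≤ n)
    (hR : ∀ x ∈ siteBall R₀, hexNorm x ≤ n) {ω : Config} {u v : Site}
    (hu : n < hexNorm u) (hv : n < hexNorm v)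
    (h : (openGraph (ω ∪ φ ω)).Reachable u v) : (openGraph ω).Reachable u v := by
  have hout : ∀ x, n < hexNorm x → x ∈ ω ∪ φ ω → x ∈ ω := by
    rintro x hx (h | h)
    · exact h
    · exact absurd (hR x (hφ.2.1 ω h)) (by omega)
  rw [SimpleGraph.reachable_iff_reflTransGen] at h
  have key : (n < hexNorm v → (openGraph ω).Reachable u v) ∧
      (hexNorm v ≤ n → ∃ a ∈ ω, hexNorm a = n + 1 ∧ (openGraph ω).Reachable u a ∧
        (openGraph ({a} ∪ inHex n (ω ∪ φ ω))).Reachable a v) := by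
    clear hv
    induction h with
    | refl => exact ⟨fun _ => SimpleGraph.Reachable.refl _, fun h => by omega⟩
    | @tail w x _ hwx ih =>
      rcases lt_or_ge n (hexNorm w) with hw | hw <;> rcases lt_or_ge n (hexNorm x) with hx | hx
      · refine ⟨fun _ => (ih.1 hw).trans (SimpleGraph.Adj.reachable ?_), fun h => by omega⟩
        exact ⟨hwx.1, hout _ hw hwx.2.1, hout _ hx hwx.2.2⟩
      · refine ⟨fun h => by omega, fun _ => ⟨w, hout _ hw hwx.2.1, ?_, ih.1 hw, ?_⟩⟩
        · have := hexNorm_le_of_adjT ((adjT_comm _ _).1 hwx.1)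
          omega
        · exact SimpleGraph.Adj.reachable ⟨hwx.1, by simp, Or.inr ⟨hwx.2.2, hx⟩⟩
      · refine ⟨fun _ => ?_, fun h => by omega⟩
        obtain ⟨a, ha, hna, hua, haw⟩ := ih.2 hw
        have hxω := hout _ hx hwx.2.2
        have hnx : hexNorm x = n + 1 := by
          have := hexNorm_le_of_adjT hwx.1
          omega
        refine hua.trans ?_
        have h1 : (openGraph ({a, x} ∪ inHex n (ω ∪ φ ω))).Reachable a x := by
          refine (haw.mono (openGraph_mono ?_)).trans (SimpleGraph.Adj.reachable ?_)
          · exact Set.union_subset_union_left _ (by simp)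
          · exact ⟨hwx.1, Or.inr ⟨hwx.2.1, hw⟩, by simp⟩
        refine (reachable_hex_of_enh hφ hness hn hR hna hnx h1).mono (openGraph_mono ?_)
        rintro y ((rfl | rfl) | hy)
        · exact ha
        · exact hxω
        · exact hy.1
      · refine ⟨fun h => by omega, fun _ => ?_⟩
        obtain ⟨a, ha, hna, hua, haw⟩ := ih.2 hw
        refine ⟨a, ha, hna, hua, haw.trans (SimpleGraph.Adj.reachable ?_)⟩
        exact ⟨hwx.1, Or.inr ⟨hwx.2.1, hw⟩, Or.inr ⟨hwx.2.2, hx⟩⟩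
  exact key.1 hv

lemma mem_enhAt {x y : Site} {ω : Config} : y ∈ enhAt φ x ω ↔ y - x ∈ φ (shiftConfig x ω) := by
  constructor
  · rintro ⟨z, hz, rfl⟩
    simpa using hz
  · intro h
    exact ⟨y - x, h, by simp⟩

lemma reachable_shift {x : Site} {ω ω' : Config} (hω : ∀ y, y ∈ ω ↔ y + x ∈ ω') {u v : Site}
    (h : (openGraph ω').Reachable u v) : (openGraph ω).Reachable (u - x) (v - x) := by
  refine reachable_retract (fun y => y - x) (fun y z hyz => SimpleGraph.Adj.reachable ?_) h
  refine ⟨?_, ?_, ?_⟩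
  · simpa only [sub_eq_add_neg, adjT_add_right] using hyz.1
  · rw [hω]; simpa using hyz.2.1
  · rw [hω]; simpa using hyz.2.2

lemma reachable_of_enhAt (hφ : IsEnhancement R₀ φ) (hness : ¬ Essential adjT φ) (hn : 0 ≤ n)
    (hR : ∀ x ∈ siteBall R₀, hexNorm x ≤ n) {ω : Config} {x u v : Site}
    (hu : n < hexNorm (u - x)) (hv : n < hexNorm (v - x))
    (h : (openGraph (ω ∪ enhAt φ x ω)).Reachable u v) : (openGraph ω).Reachable u v := by
  have h1 : (openGraph (shiftConfig x ω ∪ φ (shiftConfig x ω))).Reachable (u - x) (v - x) := by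
    refine reachable_shift (fun y => ?_) h
    simp only [Set.mem_union, mem_enhAt, add_sub_cancel_right]
    rfl
  have h2 := reachable_of_enh_zero hφ hness hn hR hu hv h1
  have h3 := reachable_shift (x := -x) (ω := ω) (fun y => by simp [shiftConfig]) h2
  simpa using h3

/-- The sites of the hexagon of radius `n` around `u`. -/
def hexAt (n : ℤ) (u : Site) : Config := {z | hexNorm (z - u) ≤ n}

lemma enhAt_mono (hmono : Monotonic φ) (x : Site) {ω ω' : Config} (h : ω ⊆ ω') :
    enhAt φ x ω ⊆ enhAt φ x ω' :=
  Set.image_mono (hmono _ _ fun _ hy => h hy)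

/-- The configuration enhanced at the sites of a list. -/
def enhList (φ : Config → Config) (ω : Config) (l : List Site) : Config :=
  ω ∪ {y | ∃ x ∈ l, y ∈ enhAt φ x ω}

lemma enhList_mono_list {ω : Config} {l l' : List Site} (h : l ⊆ l') :
    enhList φ ω l ⊆ enhList φ ω l' := by
  rintro y (hy | ⟨x, hx, hy⟩)
  · exact Or.inl hy
  · exact Or.inr ⟨x, h hx, hy⟩

lemma reachable_of_enhList (hφ : IsEnhancement R₀ φ) (hmono : Monotonic φ)
    (hness : ¬ Essential adjT φ) (hn : 0 ≤ n) (hR : ∀ x ∈ siteBall R₀, hexNorm x ≤ n)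
    {u v : Site} (l : List Site) : ∀ ω : Config, hexAt (2 * n) u ⊆ ω → hexAt (2 * n) v ⊆ ω →
    (openGraph (enhList φ ω l)).Reachable u v → (openGraph ω).Reachable u v := by
  induction l with
  | nil =>
    intro ω _ _ h
    refine h.mono (openGraph_mono ?_)
    rintro y (hy | ⟨x, hx, -⟩)
    · exact hy
    · simp at hx
  | cons x l ih =>
    intro ω hu hv h
    have hsub : ω ⊆ ω ∪ enhAt φ x ω := Set.subset_union_left
    have h1 : (openGraph (ω ∪ enhAt φ x ω)).Reachable u v := by
      refine ih _ (hu.trans hsub) (hv.trans hsub) (h.mono (openGraph_mono ?_))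
      rintro y (hy | ⟨z, hz, hy⟩)
      · exact Or.inl (Or.inl hy)
      · rcases List.mem_cons.1 hz with rfl | hz
        · exact Or.inl (Or.inr hy)
        · exact Or.inr ⟨z, hz, enhAt_mono hmono _ hsub hy⟩
    have hnear : ∀ w, hexAt (2 * n) w ⊆ ω → hexNorm (w - x) ≤ n → enhAt φ x ω ⊆ ω := by
      intro w hw hwx y hy
      refine hw ?_
      have h2 := hR _ (hφ.2.1 _ (mem_enhAt.1 hy))
      have h3 := hexNorm_add_le (y - x) (-(w - x))
      rw [hexNorm_neg, show y - x + -(w - x) = y - w by abel] at h3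
      change hexNorm (y - w) ≤ 2 * n
      omega
    rcases le_or_gt (hexNorm (u - x)) n with h2 | h2
    · rwa [Set.union_eq_self_of_subset_right (hnear u hu h2)] at h1
    rcases le_or_gt (hexNorm (v - x)) n with h3 | h3
    · rwa [Set.union_eq_self_of_subset_right (hnear v hv h3)] at h1
    exact reachable_of_enhAt hφ hness hn hR h2 h3 h1

lemma exists_enhList {ω : Config} {α : Site → Bool} {u v : Site}
    (h : (openGraph (enhanced φ ω α)).Reachable u v) :
    ∃ l, (openGraph (enhList φ ω l)).Reachable u v := by
  have hmem : ∀ y ∈ enhanced φ ω α, ∃ x, y ∈ enhList φ ω [x] := by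
    rintro y (hy | ⟨x, -, hy⟩)
    · exact ⟨0, Or.inl hy⟩
    · exact ⟨x, Or.inr ⟨x, by simp, hy⟩⟩
  obtain ⟨p⟩ := h
  induction p with
  | nil => exact ⟨[], SimpleGraph.Reachable.refl _⟩
  | @cons u w v h p ih =>
    obtain ⟨l, hl⟩ := ih
    obtain ⟨x, hx⟩ := hmem u h.2.1
    obtain ⟨y, hy⟩ := hmem w h.2.2
    refine ⟨x :: y :: l, SimpleGraph.Reachable.trans (SimpleGraph.Adj.reachable ?_)
      (hl.mono (openGraph_mono (enhList_mono_list (by simp))))⟩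
    exact ⟨h.1, enhList_mono_list (by simp) hx, enhList_mono_list (by simp) hy⟩

lemma enhanced_mono (hmono : Monotonic φ) {ω ω' : Config} (h : ω ⊆ ω') (α : Site → Bool) :
    enhanced φ ω α ⊆ enhanced φ ω' α := by
  rintro y (hy | ⟨x, hx, hy⟩)
  · exact Or.inl (h hy)
  · exact Or.inr ⟨x, hx, enhAt_mono hmono x h hy⟩

lemma subset_enhanced (ω : Config) (α : Site → Bool) : ω ⊆ enhanced φ ω α :=
  Set.subset_union_left

/-- Connections in the enhanced configuration persist without enhancement once hexagons
around the two endpoints are opened. -/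
lemma connectedIn_of_enhanced (hφ : IsEnhancement R₀ φ) (hmono : Monotonic φ)
    (hness : ¬ Essential adjT φ) (hn : 0 ≤ n) (hR : ∀ x ∈ siteBall R₀, hexNorm x ≤ n)
    {ω : Config} {α : Site → Bool} {u v : Site}
    (h : ConnectedIn adjT (enhanced φ ω α) u v) :
    ConnectedIn adjT (ω ∪ (hexAt (2 * n) u ∪ hexAt (2 * n) v)) u v := by
  rw [connectedIn_iff] at h ⊢
  refine ⟨Or.inr (Or.inl ?_), ?_⟩
  · change hexNorm (u - u) ≤ 2 * n
    simp [hexNorm, hn]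
  · obtain ⟨l, hl⟩ := exists_enhList
      (h.2.mono (openGraph_mono (enhanced_mono hmono
        (Set.subset_union_left (t := hexAt (2 * n) u ∪ hexAt (2 * n) v)) α)))
    exact reachable_of_enhList hφ hmono hness hn hR l _ (fun y hy => Or.inr (Or.inl hy))
      (fun y hy => Or.inr (Or.inr hy)) hl

/-- A connection using the hexagon around its endpoint yields a connection up to that hexagon. -/
lemma exists_connectedIn_near {m : ℤ} {ω : Config} {u v : Site} (hu : u ∈ ω)
    (h : (openGraph (ω ∪ hexAt m v)).Reachable u v) :
    ∃ w, ConnectedIn adjT ω u w ∧ (hexNorm (w - v) ≤ m + 1 ∨ w = v) := by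
  rw [SimpleGraph.reachable_iff_reflTransGen] at h
  have key : ∀ z, Relation.ReflTransGen (openGraph (ω ∪ hexAt m v)).Adj u z →
      (openGraph ω).Reachable u z ∨
      ∃ w, (openGraph ω).Reachable u w ∧ hexNorm (w - v) ≤ m + 1 := by
    intro z hz
    induction hz with
    | refl => exact Or.inl (SimpleGraph.Reachable.refl _)
    | @tail y z _ hyz ih =>
      rcases ih with ih | ih
      · rcases hyz.2.2 with hz | hz
        · exact Or.inl (ih.trans (SimpleGraph.Adj.reachable ⟨hyz.1, Reachable.mem ih hu, hz⟩))
        · refine Or.inr ⟨y, ih, ?_⟩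
          have h1 : adjT (z - v) (y - v) := by
            simpa only [sub_eq_add_neg, adjT_add_right] using (adjT_comm _ _).1 hyz.1
          exact (hexNorm_le_of_adjT h1).trans (by simpa [hexAt] using hz)
      · exact Or.inr ih
  rcases key v h with h | ⟨w, hw, hw'⟩
  · exact ⟨v, (connectedIn_iff _ _ _).2 ⟨hu, h⟩, Or.inr rfl⟩
  · exact ⟨w, (connectedIn_iff _ _ _).2 ⟨hu, hw⟩, Or.inl hw'⟩

lemma inInfiniteCluster_of_enhanced (hφ : IsEnhancement R₀ φ) (hmono : Monotonic φ)
    (hness : ¬ Essential adjT φ) (hn : 0 ≤ n) (hR : ∀ x ∈ siteBall R₀, hexNorm x ≤ n)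
    {ω : Config} {α : Site → Bool} {u : Site}
    (h : InInfiniteCluster adjT (enhanced φ ω α) u) :
    InInfiniteCluster adjT (ω ∪ hexAt (2 * n) u) u := by
  intro hfin
  refine h ((hfin.biUnion fun w _ =>
    ((finite_hexNorm_le (2 * n + 1)).image fun z => w - z)).subset ?_)
  intro v hv
  have h1 := connectedIn_of_enhanced hφ hmono hness hn hR hv
  rw [← Set.union_assoc, connectedIn_iff] at h1
  have hu : u ∈ ω ∪ hexAt (2 * n) u := by
    right
    change hexNorm (u - u) ≤ 2 * n
    simp [hexNorm, hn]
  obtain ⟨w, hw, hwv⟩ := exists_connectedIn_near hu h1.2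
  rw [Set.mem_iUnion₂]
  refine ⟨w, hw, w - v, ?_, by simp⟩
  rcases hwv with h2 | rfl
  · exact h2
  · change hexNorm (w - w) ≤ 2 * n + 1
    simp only [sub_self, hexNorm, Prod.fst_zero, Prod.snd_zero]
    omega

end Enhancement

/-! ### Bernoulli measures -/

lemma measurableSet_cylinder (F : Finset Site) (b : Site → Bool) :
    MeasurableSet (cylinder F b) := by
  have : cylinder F b = ⋂ x ∈ F, (fun η : Site → Bool => η x) ⁻¹' {b x} := by
    ext η; simp [cylinder]
  rw [this]
  exact Finset.measurableSet_biInter _ fun x _ => measurable_pi_apply x (measurableSet_singleton _)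

lemma cylinder_congr {F : Finset Site} {b b' : Site → Bool} (h : ∀ x ∈ F, b x = b' x) :
    cylinder F b = cylinder F b' := by
  ext η
  exact forall₂_congr fun x hx => by rw [h x hx]

lemma isPiSystem_cylinder :
    IsPiSystem {A : Set (Site → Bool) | ∃ F b, A = cylinder F b} := by
  classical
  rintro _ ⟨F, b, rfl⟩ _ ⟨F', b', rfl⟩ ⟨ξ, hξ, hξ'⟩
  refine ⟨F ∪ F', ξ, ?_⟩
  rw [cylinder_congr fun x hx => (hξ x hx).symm, cylinder_congr fun x hx => (hξ' x hx).symm]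
  ext η
  simp only [cylinder, Set.mem_inter_iff, Set.mem_ofPred_eq, Finset.mem_union]
  exact ⟨fun h x hx => hx.elim (h.1 x) (h.2 x),
    fun h => ⟨fun x hx => h x (Or.inl hx), fun x hx => h x (Or.inr hx)⟩⟩

lemma generateFrom_cylinder :
    (MeasurableSpace.pi : MeasurableSpace (Site → Bool)) =
      MeasurableSpace.generateFrom {A | ∃ F b, A = cylinder F b} := by
  apply le_antisymm
  · refine iSup_le fun x => ?_
    rw [MeasurableSpace.comap_le_iff_le_map]
    have : @Measurable _ _ (MeasurableSpace.generateFrom {A | ∃ F b, A = cylinder F b}) _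
        (fun η : Site → Bool => η x) := by
      refine @measurable_to_bool _ (MeasurableSpace.generateFrom _) _ ?_
      refine MeasurableSpace.measurableSet_generateFrom ⟨{x}, fun _ => true, ?_⟩
      ext η; simp [cylinder]
    exact this.le_map
  · refine MeasurableSpace.generateFrom_le ?_
    rintro _ ⟨F, b, rfl⟩
    exact measurableSet_cylinder F b

/-- Opens all sites of a finite set. -/
def openOn (B : Finset Site) (η : Site → Bool) : Site → Bool :=
  fun x => if x ∈ B then true else η x

lemma measurable_openOn (B : Finset Site) : Measurable (openOn B) := by
  refine measurable_pi_lambda _ fun x => ?_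
  by_cases hx : x ∈ B
  · simp [openOn, hx]
  · simpa [openOn, hx] using measurable_pi_apply x

lemma toConfig_openOn (B : Finset Site) (η : Site → Bool) :
    toConfig (openOn B η) = toConfig η ∪ B := by
  ext x
  by_cases hx : x ∈ B <;> simp [toConfig, openOn, hx]

section

variable {p : ℝ} {μ : Measure (Site → Bool)}

lemma IsBernoulli.map_openOn_singleton (hμ : IsBernoulli p μ) (x : Site) :
    ENNReal.ofReal p • μ.map (openOn {x}) = μ.restrict {η | η x = true} := by
  classical
  have := hμ.1
  have hcyl : ∀ F b, (ENNReal.ofReal p • μ.map (openOn {x})) (cylinder F b) =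
      μ.restrict {η | η x = true} (cylinder F b) := by
    intro F b
    rw [Measure.smul_apply, smul_eq_mul, Measure.map_apply (measurable_openOn _)
      (measurableSet_cylinder F b), Measure.restrict_apply (measurableSet_cylinder F b)]
    by_cases hb : x ∈ F ∧ b x = false
    · have h1 : openOn {x} ⁻¹' cylinder F b = ∅ := by
        ext η
        simp only [Set.mem_preimage, cylinder, Set.mem_ofPred_eq, Set.mem_empty_iff_false, iff_false]
        intro h
        have := h x hb.1
        simp [openOn, hb.2] at this
      have h2 : cylinder F b ∩ {η | η x = true} = ∅ := by
        ext η
        simp only [Set.mem_inter_iff, cylinder, Set.mem_ofPred_eq, Set.mem_empty_iff_false, iff_false]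
        rintro ⟨h, h'⟩
        rw [h x hb.1, hb.2] at h'
        simp at h'
      rw [h1, h2]; simp
    · set b' := Function.update b x true with hb'
      have hbx : x ∈ F → b x = true := fun h => by
        rw [not_and, Bool.not_eq_false] at hb
        exact hb h
      have hoff : ∀ y, y ≠ x → b' y = b y := fun y hy => Function.update_of_ne hy _ _
      have hon : b' x = true := Function.update_self _ _ _
      have h1 : openOn {x} ⁻¹' cylinder F b = cylinder (F.erase x) b' := by
        ext η
        simp only [Set.mem_preimage, cylinder, Set.mem_ofPred_eq, Finset.mem_erase]
        constructor
        · rintro h y ⟨hy, hyF⟩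
          rw [hoff y hy, ← h y hyF]
          simp [openOn, hy]
        · intro h y hyF
          by_cases hy : y = x
          · subst hy
            simp [openOn, hbx hyF]
          · rw [← hoff y hy, ← h y ⟨hy, hyF⟩]
            simp [openOn, hy]
      have h2 : cylinder F b ∩ {η | η x = true} = cylinder (insert x (F.erase x)) b' := by
        ext η
        simp only [Set.mem_inter_iff, cylinder, Set.mem_ofPred_eq, Finset.mem_insert,
          Finset.mem_erase]
        constructor
        · rintro ⟨h, h'⟩ y (rfl | ⟨hy, hyF⟩)
          · rw [h', hon]
          · rw [hoff y hy, h y hyF]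
        · intro h
          refine ⟨fun y hyF => ?_, by rw [h x (Or.inl rfl), hon]⟩
          by_cases hy : y = x
          · subst hy
            rw [h y (Or.inl rfl), hon, hbx hyF]
          · rw [h y (Or.inr ⟨hy, hyF⟩), hoff y hy]
      rw [h1, h2, hμ.2, hμ.2, Finset.prod_insert (Finset.notMem_erase x F), hon, if_pos rfl]
  have : IsFiniteMeasure (ENNReal.ofReal p • μ.map (openOn {x})) :=
    Measure.smul_finite _ ENNReal.ofReal_ne_top
  refine ext_of_generate_finite _ generateFrom_cylinder isPiSystem_cylinder ?_ ?_
  · rintro _ ⟨F, b, rfl⟩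
    exact hcyl F b
  · have := hcyl ∅ fun _ => true
    simpa [cylinder] using this

/-- Opening finitely many sites costs at most a factor `p` for each of them. -/
lemma IsBernoulli.pow_mul_openOn_le (hμ : IsBernoulli p μ) (B : Finset Site)
    {A : Set (Site → Bool)} (hA : MeasurableSet A) :
    ENNReal.ofReal p ^ B.card * μ (openOn B ⁻¹' A) ≤ μ A := by
  classical
  induction B using Finset.induction_on generalizing A with
  | empty =>
    have : openOn ∅ = id := by funext η x; simp [openOn]
    simp [this]
  | insert x B hx ih =>
    have h1 : openOn (insert x B) ⁻¹' A = openOn B ⁻¹' (openOn {x} ⁻¹' A) := by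
      have : openOn (insert x B) = openOn {x} ∘ openOn B := by
        funext η y
        by_cases hy : y = x <;> by_cases hyB : y ∈ B <;> simp [openOn, hy, hyB]
      rw [this, Set.preimage_comp]
    rw [Finset.card_insert_of_notMem hx, pow_succ', mul_assoc, h1]
    refine (mul_le_mul_right (ih (measurable_openOn _ hA)) _).trans ?_
    have h2 := congrArg (fun m => m A) (hμ.map_openOn_singleton x)
    simp only [Measure.smul_apply, smul_eq_mul, Measure.map_apply (measurable_openOn _) hA] at h2
    rw [h2]
    exact Measure.restrict_apply_le _ _

/-! ### Measurability -/

lemma measurableSet_connectedIn (x y : Site) :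
    MeasurableSet {η | ConnectedIn adjT (toConfig η) x y} := by
  have : {η | ConnectedIn adjT (toConfig η) x y} =
      ⋃ l : List Site, ⋃ _ : IsPathOn adjT l ∧ l.head? = some x ∧ l.getLast? = some y,
        {η | ∀ z ∈ l, η z = true} := by
    ext η
    simp only [ConnectedIn, Set.mem_ofPred_eq, Set.mem_iUnion, toConfig, exists_prop]
    exact exists_congr fun l => by tauto
  rw [this]
  refine MeasurableSet.iUnion fun l => MeasurableSet.iUnion fun _ => ?_
  convert measurableSet_cylinder l.toFinset fun _ => true using 1
  ext η
  simp [cylinder]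

lemma measurableSet_inInfiniteCluster (x : Site) :
    MeasurableSet {η | InInfiniteCluster adjT (toConfig η) x} := by
  have : {η | InInfiniteCluster adjT (toConfig η) x} =
      ⋂ F : Finset Site, ⋃ y : Site, ⋃ _ : y ∉ F, {η | ConnectedIn adjT (toConfig η) x y} := by
    ext η
    simp only [InInfiniteCluster, Set.mem_ofPred_eq, Set.mem_iInter, Set.mem_iUnion, exists_prop]
    constructor
    · intro h F
      obtain ⟨y, hy, hyF⟩ := h.exists_notMem_finset F
      exact ⟨y, hyF, hy⟩
    · intro h hfin
      obtain ⟨y, hy, hy'⟩ := h hfin.toFinset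
      exact hy (by simpa using hy')
  rw [this]
  exact MeasurableSet.iInter fun F => MeasurableSet.iUnion fun y => MeasurableSet.iUnion fun _ =>
    measurableSet_connectedIn x y

/-! ### Counting monochromatic paths -/

/-- There is a path of `n` steps from `v` along which `η` takes only the value `c`. -/
def pathEvent (c : Bool) (v : Site) (n : ℕ) : Set (Site → Bool) :=
  {η | ∃ l : List Site, l.length = n ∧ (v :: l).Nodup ∧ (v :: l).IsChain adjT ∧
    ∀ z ∈ v :: l, η z = c}

/-- The neighbours of a site. -/
def neighbors (v : Site) : Finset Site :=
  {v + (1, 0), v + (-1, 0), v + (0, 1), v + (0, -1), v + (1, 1), v + (-1, -1)}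

lemma card_neighbors_le (v : Site) : (neighbors v).card ≤ 6 := Finset.card_le_six

lemma mem_neighbors {v w : Site} (h : adjT v w) : w ∈ neighbors v := by
  rw [adjT_iff] at h
  simp only [neighbors, Finset.mem_insert, Finset.mem_singleton, Prod.ext_iff, Prod.fst_add,
    Prod.snd_add]
  omega

/-- The chains of `n` further sites that can follow `v`. -/
def chains : ℕ → Site → Finset (List Site)
  | 0, _ => {[]}
  | n + 1, v => (neighbors v).biUnion fun w => (chains n w).image (w :: ·)

lemma card_chains_le : ∀ (n : ℕ) (v : Site), (chains n v).card ≤ 6 ^ n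
  | 0, v => by simp [chains]
  | n + 1, v => by
    rw [chains, pow_succ']
    refine (Finset.card_biUnion_le_card_mul _ _ (6 ^ n) fun w _ => ?_).trans
      (Nat.mul_le_mul_right _ (card_neighbors_le v))
    exact Finset.card_image_le.trans (card_chains_le n w)

lemma mem_chains : ∀ (l : List Site) (v : Site), (v :: l).IsChain adjT → l ∈ chains l.length v
  | [], v, _ => by simp [chains]
  | w :: l, v, h => by
    rw [List.isChain_cons_cons] at h
    rw [List.length_cons, chains, Finset.mem_biUnion]
    exact ⟨w, mem_neighbors h.1, Finset.mem_image_of_mem _ (mem_chains l w h.2)⟩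

lemma IsBernoulli.pathEvent_le (hμ : IsBernoulli p μ) (c : Bool) (v : Site) (n : ℕ) :
    μ (pathEvent c v n) ≤ 6 ^ n * ENNReal.ofReal (if c then p else 1 - p) ^ (n + 1) := by
  classical
  have hsub : pathEvent c v n ⊆ ⋃ l ∈ (chains n v).filter (fun l => l.length = n ∧ (v :: l).Nodup),
      cylinder (v :: l).toFinset fun _ => c := by
    rintro η ⟨l, hl, hnd, hc, hη⟩
    rw [Set.mem_iUnion₂]
    refine ⟨l, Finset.mem_filter.2 ⟨hl ▸ mem_chains l v hc, hl, hnd⟩, fun x hx => ?_⟩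
    exact hη x (List.mem_toFinset.1 hx)
  refine (measure_mono hsub).trans ((measure_biUnion_finset_le _ _).trans ?_)
  refine (Finset.sum_le_card_nsmul _ _
    (ENNReal.ofReal (if c then p else 1 - p) ^ (n + 1)) fun l hl => ?_).trans ?_
  · obtain ⟨-, hl, hnd⟩ := Finset.mem_filter.1 hl
    rw [hμ.2, Finset.prod_const, List.toFinset_card_of_nodup hnd, List.length_cons, hl]
  · rw [nsmul_eq_mul]
    refine mul_le_mul_left ?_ _
    exact_mod_cast (Finset.card_filter_le _ _).trans (card_chains_le n v)

end

/-! ### The critical point lies strictly between `0` and `1` -/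

lemma triangle_sum_eq_zero {a b c k l m : Prop} [Decidable a] [Decidable b]
    [Decidable c] [Decidable k] [Decidable l] [Decidable m] (hk : k → ¬ a) (hl : l → ¬ b)
    (hm : m → ¬ c) (h1 : a → l → ¬ c → m) (h2 : a → m → ¬ b → l) (h3 : b → k → ¬ c → m)
    (h4 : b → m → ¬ a → k) (h5 : c → k → ¬ b → l) (h6 : c → l → ¬ a → k) :
    (((if a then 1 else 0) * (if l then 1 else 0) + (if b then 1 else 0) * (if k then 1 else 0)) +
      ((if b then 1 else 0) * (if m then 1 else 0) + (if c then 1 else 0) * (if l then 1 else 0)) +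
      ((if a then 1 else 0) * (if m then 1 else 0) + (if c then 1 else 0) * (if k then 1 else 0)) :
      ZMod 2) = 0 := by
  have two : (1 : ZMod 2) + 1 = 0 := rfl
  by_cases a <;> by_cases b <;> by_cases c <;> by_cases k <;> by_cases l <;> by_cases m <;> simp_all

/-- A finite cluster of the origin is surrounded by closed sites joining the two halves of
the first coordinate axis. -/
lemma exists_closed_arc {ω : Config} (h0 : (0 : Site) ∈ ω) (hfin : ¬ InInfiniteCluster adjT ω 0) :
    ∃ k : ℤ, 0 < k ∧ ((k, 0) : Site) ∉ ω ∧
      ∃ j : ℤ, j ≤ 0 ∧ (openGraph ωᶜ).Reachable (k, 0) (j, 0) := by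
  classical
  rw [InInfiniteCluster, Set.not_infinite] at hfin
  set C : Set Site := {y | ConnectedIn adjT ω 0 y} with hC
  have h0C : (0 : Site) ∈ C := (connectedIn_iff _ _ _).2 ⟨h0, SimpleGraph.Reachable.refl _⟩
  have hclosed : ∀ u v, u ∈ C → v ∉ C → adjT u v → v ∉ ω := by
    intro u v hu hv huv hvω
    have hu' := (connectedIn_iff _ _ _).1 hu
    exact hv ((connectedIn_iff _ _ _).2 ⟨h0, hu'.2.trans
      (SimpleGraph.Adj.reachable ⟨huv, Reachable.mem hu'.2 h0, hvω⟩)⟩)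
  set K : Set Site := {v | v ∉ C ∧ (∃ u ∈ C, adjT u v) ∧
    ∃ k : ℤ, 0 < k ∧ ((k, 0) : Site) ∉ ω ∧ (openGraph ωᶜ).Reachable (k, 0) v} with hK
  by_contra hcon
  have hneg : ∀ j : ℤ, j ≤ 0 → ((j, 0) : Site) ∉ K := by
    rintro j hj ⟨-, -, k, hk, hkω, hr⟩
    exact hcon ⟨k, hk, hkω, j, hj, hr⟩
  have hKC : ∀ v ∈ K, v ∉ C := fun v hv => hv.1
  have hKK : ∀ u v w, u ∈ C → v ∈ K → w ∉ C → adjT u w → adjT v w → w ∈ K := by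
    rintro u v w hu ⟨hvC, ⟨u', hu', huv⟩, k, hk, hkω, hr⟩ hw huw hvw
    exact ⟨hw, ⟨u, hu, huw⟩, k, hk, hkω, hr.trans (SimpleGraph.Adj.reachable
      ⟨hvw, hclosed u' v hu' hvC huv, hclosed u w hu hw huw⟩)⟩
  set c : Site → ZMod 2 := fun x => if x ∈ C then 1 else 0 with hc
  set κ : Site → ZMod 2 := fun x => if x ∈ K then 1 else 0 with hκ
  set g : Site → Site → ZMod 2 := fun x y => c x * κ y + c y * κ x with hg
  have htri : ∀ x y z, adjT x y → adjT y z → adjT x z → g x y + g y z + g x z = 0 := by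
    intro x y z hxy hyz hxz
    have hyx := (adjT_comm _ _).1 hxy
    have hzy := (adjT_comm _ _).1 hyz
    have hzx := (adjT_comm _ _).1 hxz
    exact triangle_sum_eq_zero (a := x ∈ C) (b := y ∈ C) (c := z ∈ C) (k := x ∈ K) (l := y ∈ K)
      (m := z ∈ K) (hKC x) (hKC y) (hKC z)
      (fun h1 h2 h3 => hKK x y z h1 h2 h3 hxz hyz) (fun h1 h2 h3 => hKK x z y h1 h2 h3 hxy hzy)
      (fun h1 h2 h3 => hKK y x z h1 h2 h3 hyz hxz) (fun h1 h2 h3 => hKK y z x h1 h2 h3 hyx hzx)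
      (fun h1 h2 h3 => hKK z x y h1 h2 h3 hzy hxy) (fun h1 h2 h3 => hKK z y x h1 h2 h3 hzx hyx)
  obtain ⟨M, hM1, hM⟩ : ∃ M : ℕ, 1 ≤ M ∧ ∀ x ∈ C, hexNorm x < M := by
    obtain ⟨B, hB⟩ := (hfin.image hexNorm).bddAbove
    refine ⟨B.toNat + 1, by omega, fun x hx => ?_⟩
    have := hB (Set.mem_image_of_mem _ hx)
    push_cast
    omega
  have hout : ∀ x : Site, ((M : ℤ) ≤ x.1 ∨ x.1 ≤ -M ∨ (M : ℤ) ≤ x.2) → x ∉ C := by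
    intro x hx hxC
    have h1 := hM x hxC
    have h2 := (hexNorm_le_iff x _).1 le_rfl
    omega
  have hgout : ∀ x y, x ∉ C → y ∉ C → g x y = 0 := by
    intro x y hx hy
    simp [hg, hc, hx, hy]
  set S : ℤ → ZMod 2 := fun y => ∑ i ∈ Finset.range (2 * M),
    g ((i : ℤ) - M, y) ((i : ℤ) - M + 1, y) with hS
  have hSstep : ∀ y, S (y + 1) = S y := by
    intro y
    have h1 : ∀ i : ℕ, g ((i : ℤ) - M, y + 1) ((i : ℤ) - M + 1, y + 1) =
        g ((i : ℤ) - M, y) ((i : ℤ) - M + 1, y) +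
        (g (((i + 1 : ℕ) : ℤ) - M, y) (((i + 1 : ℕ) : ℤ) - M, y + 1) -
          g ((i : ℤ) - M, y) ((i : ℤ) - M, y + 1)) := by
      intro i
      have e : ((i + 1 : ℕ) : ℤ) - M = (i : ℤ) - M + 1 := by push_cast; ring
      rw [e]
      have t1 := htri ((i : ℤ) - M, y) ((i : ℤ) - M + 1, y) ((i : ℤ) - M + 1, y + 1)
        (by rw [adjT_iff]; simp) (by rw [adjT_iff]; simp) (by rw [adjT_iff]; simp)
      have t2 := htri ((i : ℤ) - M, y) ((i : ℤ) - M, y + 1) ((i : ℤ) - M + 1, y + 1)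
        (by rw [adjT_iff]; simp) (by rw [adjT_iff]; simp) (by rw [adjT_iff]; simp)
      linear_combination t2 - t1
    simp only [hS]
    rw [Finset.sum_congr rfl fun i _ => h1 i, Finset.sum_add_distrib,
      Finset.sum_range_sub (fun i : ℕ => g ((i : ℤ) - M, y) ((i : ℤ) - M, y + 1)),
      hgout _ _ (hout _ (by left; push_cast; omega)) (hout _ (by left; push_cast; omega)),
      hgout _ _ (hout _ (by right; left; push_cast; omega))
        (hout _ (by right; left; push_cast; omega))]
    simp
  have hS0 : S 0 = 0 := by
    have h1 : ∀ n : ℕ, S n = S 0 := by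
      intro n
      induction n with
      | zero => simp
      | succ n ih => rw [← ih, ← hSstep n]; push_cast; rfl
    rw [← h1 M]
    exact Finset.sum_eq_zero fun i _ => hgout _ _ (hout _ (by simp)) (hout _ (by simp))
  set F : ℤ → ZMod 2 := fun x => if 0 ≤ x then c (x, 0) else 1 with hF
  have hc0 : c (0, 0) = 1 := if_pos h0C
  have hgF : ∀ x : ℤ, g (x, 0) (x + 1, 0) = F x - F (x + 1) := by
    intro x
    have hadj : adjT ((x, 0) : Site) (x + 1, 0) := by rw [adjT_iff]; simp
    rcases lt_or_ge x 0 with hx | hx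
    · have k1 := hneg x hx.le
      have k2 := hneg (x + 1) (by omega)
      have hF1 : F x = 1 := if_neg (by omega)
      have hF2 : F (x + 1) = 1 := by
        rcases lt_or_ge (x + 1) 0 with h | h
        · exact if_neg (by omega)
        · have : x + 1 = 0 := by omega
          rw [this]
          simpa [hF] using hc0
      rw [hF1, hF2]
      simp [hg, hκ, k1, k2]
    · have hF1 : F x = c (x, 0) := if_pos hx
      have hF2 : F (x + 1) = c (x + 1, 0) := if_pos (by omega)
      rw [hF1, hF2]
      by_cases c1 : ((x, 0) : Site) ∈ C <;> by_cases c2 : ((x + 1, 0) : Site) ∈ C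
      · have k1 : ((x, 0) : Site) ∉ K := fun h => hKC _ h c1
        have k2 : ((x + 1, 0) : Site) ∉ K := fun h => hKC _ h c2
        simp [hg, hc, hκ, c1, c2, k1, k2]
      · have k2 : ((x + 1, 0) : Site) ∈ K := ⟨c2, ⟨_, c1, hadj⟩, x + 1, by omega,
          hclosed _ _ c1 c2 hadj, SimpleGraph.Reachable.refl _⟩
        simp [hg, hc, hκ, c1, c2, k2]
      · have hx0 : x ≠ 0 := by
          rintro rfl
          exact c1 h0C
        have hadj' := (adjT_comm _ _).1 hadj
        have k1 : ((x, 0) : Site) ∈ K := ⟨c1, ⟨_, c2, hadj'⟩, x, by omega,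
          hclosed _ _ c2 c1 hadj', SimpleGraph.Reachable.refl _⟩
        simp [hg, hc, hκ, c1, c2, k1]
      · simp [hg, hc, c1, c2]
  have hS1 : S 0 = 1 := by
    have h1 : ∀ i : ℕ, g ((i : ℤ) - M, 0) ((i : ℤ) - M + 1, 0) =
        F ((i : ℤ) - M) - F (((i + 1 : ℕ) : ℤ) - M) := by
      intro i
      rw [hgF]
      congr 2
      push_cast; ring
    simp only [hS]
    rw [Finset.sum_congr rfl fun i _ => h1 i,
      Finset.sum_range_sub' (fun i : ℕ => F ((i : ℤ) - M))]
    have hF1 : F (((0 : ℕ) : ℤ) - M) = 1 := if_neg (by push_cast; omega)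
    have hF2 : F (((2 * M : ℕ) : ℤ) - M) = 0 := by
      simp only [hF]
      rw [if_pos (by push_cast; omega)]
      exact if_neg (hout _ (by left; push_cast; omega))
    rw [hF1, hF2, sub_zero]
  rw [hS0] at hS1
  exact absurd hS1 (by decide)

lemma exists_pathEvent_of_not_inInfiniteCluster {η : Site → Bool}
    (h : ¬ InInfiniteCluster adjT (toConfig η) 0) :
    ∃ k : ℕ, η ∈ pathEvent false ((k : ℤ), 0) k := by
  by_cases h0 : (0 : Site) ∈ toConfig η
  · obtain ⟨k, hk, hkω, j, hj, hr⟩ := exists_closed_arc h0 h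
    refine ⟨k.toNat, ?_⟩
    have hk' : ((k.toNat : ℕ) : ℤ) = k := by omega
    obtain ⟨l, hl, hnd, hc, hm⟩ := exists_path_of_le_hexNorm (n := k.toNat)
      (x := (k, 0)) hkω hr (by
        have := (hexNorm_le_iff (((j, 0) : Site) - (k, 0)) _).1 le_rfl
        simp only [Prod.fst_sub] at this
        omega)
    rw [hk']
    exact ⟨l, hl, hnd, hc, fun z hz => by simpa [toConfig] using hm z hz⟩
  · refine ⟨0, [], rfl, by simp, by simp, fun z hz => ?_⟩
    simp only [Nat.cast_zero, List.mem_singleton] at hz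
    subst hz
    exact Bool.not_eq_true _ ▸ h0

lemma pathEvent_of_inInfiniteCluster {η : Site → Bool}
    (h : InInfiniteCluster adjT (toConfig η) 0) (n : ℕ) : η ∈ pathEvent true 0 n := by
  obtain ⟨y, hy, hyn⟩ := h.exists_notMem_finset (finite_hexNorm_le n).toFinset
  rw [Set.Finite.mem_toFinset, Set.mem_ofPred_eq, not_le] at hyn
  have hy' := (connectedIn_iff _ _ _).1 hy
  obtain ⟨l, hl, hnd, hc, hm⟩ := exists_path_of_le_hexNorm (n := n) hy'.1 hy'.2
    (by simpa using hyn.le)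
  exact ⟨l, hl, hnd, hc, hm⟩

lemma six_pow_mul_le {q : ℝ} (hq : q ≤ 1 / 12) (n : ℕ) :
    (6 : ℝ≥0∞) ^ n * ENNReal.ofReal q ^ (n + 1) ≤ 12⁻¹ * 2⁻¹ ^ n := by
  have h1 : ENNReal.ofReal q ≤ 12⁻¹ := by
    refine (ENNReal.ofReal_le_ofReal hq).trans ?_
    rw [one_div, ENNReal.ofReal_inv_of_pos (by norm_num)]
    norm_num
  have h2 : (6 : ℝ≥0∞) * 12⁻¹ = 2⁻¹ := by
    rw [show (12 : ℝ≥0∞) = 6 * 2 by norm_num,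
      ENNReal.mul_inv (Or.inl (by norm_num)) (Or.inl (by norm_num)), ← mul_assoc,
      ENNReal.mul_inv_cancel (by norm_num) (by norm_num), one_mul]
  calc (6 : ℝ≥0∞) ^ n * ENNReal.ofReal q ^ (n + 1) ≤ 6 ^ n * 12⁻¹ ^ (n + 1) := by gcongr
    _ = 12⁻¹ * (6 * 12⁻¹) ^ n := by rw [pow_succ, mul_pow]; ring
    _ = 12⁻¹ * 2⁻¹ ^ n := by rw [h2]

lemma theta_eq_zero_of_le {p : ℝ} {μ : Measure (Site → Bool)} (hμ : IsBernoulli p μ)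
    (hp : p ≤ 1 / 12) : theta adjT μ = 0 := by
  have h1 : ∀ n : ℕ, μ {η | InInfiniteCluster adjT (toConfig η) 0} ≤ 12⁻¹ * 2⁻¹ ^ n := fun n =>
    ((measure_mono fun η hη => pathEvent_of_inInfiniteCluster hη n).trans
      (hμ.pathEvent_le true 0 n)).trans (by simpa using six_pow_mul_le hp n)
  have h2 : Tendsto (fun n : ℕ => (12 : ℝ≥0∞)⁻¹ * 2⁻¹ ^ n) atTop (𝓝 (12⁻¹ * 0)) :=
    ENNReal.Tendsto.const_mul (ENNReal.tendsto_pow_atTop_nhds_zero_of_lt_one (by simp))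
      (Or.inr (by simp))
  rw [mul_zero] at h2
  have h3 := ge_of_tendsto' h2 h1
  rw [theta, le_zero_iff.1 h3, ENNReal.toReal_zero]

lemma theta_ne_zero_of_ge {p : ℝ} {μ : Measure (Site → Bool)} (hμ : IsBernoulli p μ)
    (hp : 11 / 12 ≤ p) : theta adjT μ ≠ 0 := by
  have := hμ.1
  set A : Set (Site → Bool) := {η | InInfiniteCluster adjT (toConfig η) 0} with hA
  have h1 : μ Aᶜ ≤ 6⁻¹ := by
    have hsub : Aᶜ ⊆ ⋃ k : ℕ, pathEvent false ((k : ℤ), 0) k := fun η hη =>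
      Set.mem_iUnion.2 (exists_pathEvent_of_not_inInfiniteCluster hη)
    refine (measure_mono hsub).trans ((measure_iUnion_le _).trans ?_)
    refine (ENNReal.tsum_le_tsum fun k : ℕ => (hμ.pathEvent_le false _ k).trans
      (by simpa using six_pow_mul_le (q := 1 - p) (by linarith) k)).trans ?_
    rw [ENNReal.tsum_mul_left, ENNReal.tsum_geometric, ENNReal.one_sub_inv_two, inv_inv,
      show (12 : ℝ≥0∞) = 6 * 2 by norm_num,
      ENNReal.mul_inv (Or.inl (by norm_num)) (Or.inl (by norm_num)), mul_assoc,
      ENNReal.inv_mul_cancel (by norm_num) (by norm_num), mul_one]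
  intro h
  rw [theta, ENNReal.toReal_eq_zero_iff] at h
  have h0 : μ A = 0 := h.resolve_right (measure_ne_top μ A)
  have h2 : (1 : ℝ≥0∞) ≤ μ A + μ Aᶜ := by
    rw [← measure_univ (μ := μ), ← Set.union_compl_self A]
    exact measure_union_le _ _
  rw [h0, zero_add] at h2
  have h3 := h2.trans h1
  rw [ENNReal.le_inv_iff_mul_le] at h3
  norm_num at h3

lemma pcOf_bounds {P : ℝ → Measure (Site → Bool)} (hP : ∀ p ∈ Icc (0:ℝ) 1, IsBernoulli p (P p)) :
    0 < pcOf adjT P ∧ pcOf adjT P < 1 := by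
  have hmem : (1 / 12 : ℝ) ∈ {p | p ∈ Icc (0:ℝ) 1 ∧ theta adjT (P p) = 0} := by
    have : (1 / 12 : ℝ) ∈ Icc (0:ℝ) 1 := by constructor <;> norm_num
    exact ⟨this, theta_eq_zero_of_le (hP _ this) le_rfl⟩
  constructor
  · have h1 : BddAbove {p | p ∈ Icc (0:ℝ) 1 ∧ theta adjT (P p) = 0} := ⟨1, fun p hp => hp.1.2⟩
    exact lt_of_lt_of_le (by norm_num) (le_csSup h1 hmem)
  · refine lt_of_le_of_lt (b := 11 / 12) (csSup_le ⟨_, hmem⟩ fun p hp => ?_) (by norm_num)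
    by_contra hlt
    exact theta_ne_zero_of_ge (hP p hp.1) (not_le.1 hlt).le hp.2

/-! ### Comparison of the enhanced and the original process -/

/-- The hexagon `hexAt n x` as a finite set. -/
noncomputable def hexFinset (n : ℤ) (x : Site) : Finset Site :=
  (finite_hexNorm_le n).toFinset.map (addRightEmbedding x)

lemma coe_hexFinset (n : ℤ) (x : Site) : (hexFinset n x : Set Site) = hexAt n x := by
  ext z
  simp only [hexFinset, Finset.coe_map, Set.Finite.coe_toFinset, addRightEmbedding_apply,
    Set.mem_image, hexAt, Set.mem_ofPred_eq]
  exact ⟨by rintro ⟨y, hy, rfl⟩; simpa using hy, fun h => ⟨z - x, h, sub_add_cancel z x⟩⟩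

section

variable {R₀ : ℝ} {φ : Config → Config} {p : ℝ} {μ ν : Measure (Site → Bool)}

lemma IsBernoulli.pow_mul_prod_le [IsProbabilityMeasure ν] (hμ : IsBernoulli p μ) (hp : p ≤ 1)
    {B : Finset Site} {N : ℕ} (hB : B.card ≤ N) {A : Set (Site → Bool)} (hA : MeasurableSet A)
    {E : Set ((Site → Bool) × (Site → Bool))} (hE : ∀ z ∈ E, openOn B z.1 ∈ A) :
    ENNReal.ofReal p ^ N * (μ.prod ν) E ≤ μ A := by
  have := hμ.1
  have hsub : E ⊆ (openOn B ⁻¹' A) ×ˢ Set.univ := fun z hz => ⟨hE z hz, Set.mem_univ _⟩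
  calc ENNReal.ofReal p ^ N * (μ.prod ν) E
      ≤ ENNReal.ofReal p ^ B.card * (μ.prod ν) ((openOn B ⁻¹' A) ×ˢ Set.univ) :=
        mul_le_mul' (pow_le_pow_right_of_le_one' (ENNReal.ofReal_le_one.2 hp) hB) (measure_mono hsub)
    _ = ENNReal.ofReal p ^ B.card * μ (openOn B ⁻¹' A) := by
        rw [Measure.prod_prod, measure_univ, mul_one]
    _ ≤ μ A := hμ.pow_mul_openOn_le B hA

lemma measure_le_prod_of_forall [SFinite μ] [IsProbabilityMeasure ν] {A : Set (Site → Bool)}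
    {E : Set ((Site → Bool) × (Site → Bool))} (h : ∀ η ∈ A, ∀ α, (η, α) ∈ E) :
    μ A ≤ (μ.prod ν) E := by
  calc μ A = (μ.prod ν) (A ×ˢ Set.univ) := by rw [Measure.prod_prod, measure_univ, mul_one]
    _ ≤ (μ.prod ν) E := measure_mono fun z hz => h z.1 hz.1 z.2

/-- For a monotonic nonessential enhancement, connection probabilities before and after the
enhancement differ by at most a fixed power of the density. -/
lemma exists_pow_mul_prod_le (hφ : IsEnhancement R₀ φ) (hmono : Monotonic φ)
    (hness : ¬ Essential adjT φ) :
    ∃ N : ℕ, ∀ (p : ℝ) (μ ν : Measure (Site → Bool)), p ≤ 1 → IsBernoulli p μ →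
      IsProbabilityMeasure ν →
      (∀ x, ENNReal.ofReal p ^ N *
          (μ.prod ν) {ηα | ConnectedIn adjT (enhanced φ (toConfig ηα.1) ηα.2) 0 x} ≤
        μ {η | ConnectedIn adjT (toConfig η) 0 x}) ∧
      ENNReal.ofReal p ^ N *
          (μ.prod ν) {ηα | InInfiniteCluster adjT (enhanced φ (toConfig ηα.1) ηα.2) 0} ≤
        μ {η | InInfiniteCluster adjT (toConfig η) 0} := by
  classical
  obtain ⟨n, hn, hR⟩ := exists_hexNorm_le_of_mem_siteBall R₀
  set m := (finite_hexNorm_le (2 * n)).toFinset.card with hm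
  have hcard : ∀ x, (hexFinset (2 * n) x).card = m := fun x => Finset.card_map _
  refine ⟨m + m, fun p μ ν hp hμ hν => ⟨fun x => ?_, ?_⟩⟩
  · refine hμ.pow_mul_prod_le hp (B := hexFinset (2 * n) 0 ∪ hexFinset (2 * n) x) ?_
      (measurableSet_connectedIn 0 x) fun z hz => ?_
    · exact (Finset.card_union_le _ _).trans (by rw [hcard, hcard])
    · rw [Set.mem_ofPred_eq, toConfig_openOn, Finset.coe_union, coe_hexFinset, coe_hexFinset]
      exact connectedIn_of_enhanced hφ hmono hness hn hR hz
  · refine hμ.pow_mul_prod_le hp (B := hexFinset (2 * n) 0) (by rw [hcard]; omega)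
      (measurableSet_inInfiniteCluster 0) fun z hz => ?_
    rw [Set.mem_ofPred_eq, toConfig_openOn, coe_hexFinset]
    exact inInfiniteCluster_of_enhanced hφ hmono hness hn hR hz

lemma measure_connectedIn_le_enhanced [SFinite μ] [IsProbabilityMeasure ν] (φ : Config → Config)
    (x : Site) : μ {η | ConnectedIn adjT (toConfig η) 0 x} ≤
      (μ.prod ν) {ηα | ConnectedIn adjT (enhanced φ (toConfig ηα.1) ηα.2) 0 x} :=
  measure_le_prod_of_forall fun _ hη α => ConnectedIn.mono (subset_enhanced _ α) hη

lemma tau_le_tauEnh [IsProbabilityMeasure μ] [IsProbabilityMeasure ν] (φ : Config → Config)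
    (x : Site) : tau adjT μ x ≤ tauEnh adjT φ μ ν x :=
  ENNReal.toReal_mono (measure_ne_top _ _) (measure_connectedIn_le_enhanced φ x)

lemma theta_le_thetaEnh [IsProbabilityMeasure μ] [IsProbabilityMeasure ν] (φ : Config → Config) :
    theta adjT μ ≤ thetaEnh adjT φ μ ν :=
  ENNReal.toReal_mono (measure_ne_top _ _)
    (measure_le_prod_of_forall fun _ hη α => InInfiniteCluster.mono (subset_enhanced _ α) hη)

/-- For a monotonic nonessential enhancement, the functions `τ`, `θ` and `χ` before and after the
enhancement differ by at most a constant factor, uniformly in densities bounded below. -/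
lemma exists_comparison (hφ : IsEnhancement R₀ φ) (hmono : Monotonic φ)
    (hness : ¬ Essential adjT φ) {p₀ : ℝ} (hp₀ : 0 < p₀) :
    ∃ c : ℝ, 0 < c ∧ ∀ (p : ℝ) (μ ν : Measure (Site → Bool)), p₀ ≤ p → p ≤ 1 →
      IsBernoulli p μ → IsProbabilityMeasure ν →
      (∀ x, c * tauEnh adjT φ μ ν x ≤ tau adjT μ x ∧ tau adjT μ x ≤ tauEnh adjT φ μ ν x) ∧
      (c * thetaEnh adjT φ μ ν ≤ theta adjT μ ∧ theta adjT μ ≤ thetaEnh adjT φ μ ν) ∧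
      (c * (chiEnh adjT φ μ ν).toReal ≤ (chi adjT μ).toReal ∧
        (chi adjT μ).toReal ≤ (chiEnh adjT φ μ ν).toReal) := by
  obtain ⟨N, hN⟩ := exists_pow_mul_prod_le hφ hmono hness
  refine ⟨p₀ ^ N, pow_pos hp₀ N, fun p μ ν hp hp1 hμ hν => ?_⟩
  have := hμ.1
  obtain ⟨h1, h2⟩ := hN p μ ν hp1 hμ hν
  have hpow : ENNReal.ofReal p₀ ^ N ≤ ENNReal.ofReal p ^ N :=
    pow_le_pow_left' (ENNReal.ofReal_le_ofReal hp) N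
  have hreal : ∀ {a b : ℝ≥0∞}, b ≠ ⊤ → ENNReal.ofReal p ^ N * a ≤ b →
      p₀ ^ N * a.toReal ≤ b.toReal := by
    intro a b hb hab
    have := ENNReal.toReal_mono hb ((mul_le_mul_left hpow a).trans hab)
    rwa [ENNReal.toReal_mul, ENNReal.toReal_pow, ENNReal.toReal_ofReal hp₀.le] at this
  refine ⟨fun x => ⟨hreal (measure_ne_top _ _) (h1 x), tau_le_tauEnh φ x⟩,
    ⟨hreal (measure_ne_top _ _) h2, theta_le_thetaEnh φ⟩, ?_⟩
  have h3 : ENNReal.ofReal p ^ N * chiEnh adjT φ μ ν ≤ chi adjT μ := by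
    rw [chiEnh, chi, ← ENNReal.tsum_mul_left]
    exact ENNReal.tsum_le_tsum h1
  have h4 : chi adjT μ ≤ chiEnh adjT φ μ ν :=
    ENNReal.tsum_le_tsum fun x => measure_connectedIn_le_enhanced φ x
  by_cases htop : chi adjT μ = ⊤
  · have : chiEnh adjT φ μ ν = ⊤ := top_le_iff.1 (htop ▸ h4)
    simp [htop, this]
  · have htop' : chiEnh adjT φ μ ν ≠ ⊤ := by
      intro h
      have hne : ENNReal.ofReal p ^ N ≠ 0 :=
        pow_ne_zero _ (ENNReal.ofReal_pos.2 (hp₀.trans_le hp)).ne'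
      rw [h, ENNReal.mul_top hne] at h3
      exact htop (top_le_iff.1 h3)
    exact ⟨hreal htop h3, ENNReal.toReal_mono htop' h4⟩

end

/-! ### Logarithmic asymptotics -/

lemma abs_log_sub_log_le {a b c : ℝ} (hc : 0 < c) (ha : 0 ≤ a) (hcb : c * b ≤ a) (hab : a ≤ b) :
    |Real.log b - Real.log a| ≤ |Real.log c| := by
  rcases ha.eq_or_lt with rfl | ha
  · have : b = 0 := le_antisymm (by nlinarith) hab
    simp [this]
  · have hb := ha.trans_le hab
    have h1 := Real.log_le_log ha hab
    have h2 := Real.log_le_log (mul_pos hc hb) hcb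
    rw [Real.log_mul hc.ne' hb.ne'] at h2
    rw [abs_of_nonneg (by linarith)]
    exact le_trans (by linarith) (neg_le_abs _)

/-- Functions that differ by at most a constant factor have the same logarithmic asymptotics. -/
lemma tendsto_log_div_of_comparable {ι : Type*} {l : Filter ι} {f g D : ι → ℝ} {c L : ℝ}
    (hc : 0 < c) (hf : ∀ i, 0 ≤ f i) (hfg : ∀ᶠ i in l, c * g i ≤ f i ∧ f i ≤ g i)
    (hD : Tendsto (fun i => (D i)⁻¹) l (𝓝 0))
    (h : Tendsto (fun i => Real.log (f i) / D i) l (𝓝 L)) :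
    Tendsto (fun i => Real.log (g i) / D i) l (𝓝 L) := by
  have h0 : Tendsto (fun i => (Real.log (g i) - Real.log (f i)) * (D i)⁻¹) l (𝓝 0) := by
    refine squeeze_zero_norm' (a := fun i => |Real.log c| * |(D i)⁻¹|) ?_ ?_
    · filter_upwards [hfg] with i hi
      rw [Real.norm_eq_abs, abs_mul]
      exact mul_le_mul_of_nonneg_right (abs_log_sub_log_le hc (hf i) hi.1 hi.2) (abs_nonneg _)
    · simpa using hD.abs.const_mul |Real.log c|
  refine (add_zero L ▸ h.add h0).congr fun i => ?_
  rw [div_eq_mul_inv, div_eq_mul_inv]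
  ring

lemma tendsto_inv_log_sub_nhdsGT (a : ℝ) :
    Tendsto (fun p : ℝ => (Real.log (p - a))⁻¹) (𝓝[>] a) (𝓝 0) := by
  refine tendsto_inv_atBot_zero.comp (Real.tendsto_log_nhdsGT_zero.comp ?_)
  refine tendsto_nhdsWithin_iff.2 ⟨?_, ?_⟩
  · have : Tendsto (fun p : ℝ => p - a) (𝓝 a) (𝓝 (a - a)) := by
      exact (continuous_id.sub continuous_const).tendsto a
    rw [sub_self] at this
    exact this.mono_left nhdsWithin_le_nhds
  · filter_upwards [self_mem_nhdsWithin] with p hp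
    exact sub_pos.2 (Set.mem_Ioi.1 hp)

lemma tendsto_inv_log_sub_nhdsLT (a : ℝ) :
    Tendsto (fun p : ℝ => (Real.log (a - p))⁻¹) (𝓝[<] a) (𝓝 0) := by
  refine tendsto_inv_atBot_zero.comp (Real.tendsto_log_nhdsGT_zero.comp ?_)
  refine tendsto_nhdsWithin_iff.2 ⟨?_, ?_⟩
  · have : Tendsto (fun p : ℝ => a - p) (𝓝 a) (𝓝 (a - a)) := by
      exact (continuous_const.sub continuous_id).tendsto a
    rw [sub_self] at this
    exact this.mono_left nhdsWithin_le_nhds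
  · filter_upwards [self_mem_nhdsWithin] with p hp
    exact sub_pos.2 (Set.mem_Iio.1 hp)

/-- for a monotonic nonessential enhancement of site percolation on
the triangular lattice and `s ∈ [0,1]`, the critical exponents `β, η, ν, γ`, if they
exist for the independent process, exist for the enhanced process with the same values. -/
theorem critical_exponents_unchanged_triangular
    (P : ℝ → Measure (Site → Bool))
    (hP : ∀ p ∈ Icc (0:ℝ) 1, IsBernoulli p (P p))
    (R₀ : ℝ) (φ : Config → Config) (hφ : IsEnhancement R₀ φ)
    (hmono : Monotonic φ) (hness : ¬ Essential adjT φ)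
    (s : ℝ) (hs : s ∈ Icc (0:ℝ) 1) :
    -- (i) the exponent β (percolation probability)
    (∀ β : ℝ,
      Tendsto (fun p => Real.log (theta adjT (P p)) / Real.log (p - pcOf adjT P))
        (𝓝[>] (pcOf adjT P)) (𝓝 β) →
      Tendsto (fun p => Real.log (thetaEnh adjT φ (P p) (P s)) / Real.log (p - pcOf adjT P))
        (𝓝[>] (pcOf adjT P)) (𝓝 β)) ∧
    -- (ii) the exponent η (connectivity function at criticality)
    (∀ ηexp : ℝ,
      Tendsto (fun x : Site =>
          Real.log (tau adjT (P (pcOf adjT P)) x) / Real.log (siteNorm x))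
        (comap siteNorm atTop) (𝓝 (-ηexp)) →
      Tendsto (fun x : Site =>
          Real.log (tauEnh adjT φ (P (pcOf adjT P)) (P s) x) / Real.log (siteNorm x))
        (comap siteNorm atTop) (𝓝 (-ηexp))) ∧
    -- (iii) the exponent ν (correlation length)
    (∀ νexp : ℝ, ∀ ξ : ℝ → ℝ,
      (∀ p : ℝ, 0 < p → p < pcOf adjT P →
        Tendsto (fun x : Site => -Real.log (tau adjT (P p) x) / siteNorm x)
          (comap siteNorm atTop) (𝓝 (ξ p)⁻¹)) →
      Tendsto (fun p => Real.log (ξ p) / Real.log (pcOf adjT P - p))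
        (𝓝[<] (pcOf adjT P)) (𝓝 (-νexp)) →
      ∃ ξ' : ℝ → ℝ,
        (∀ p : ℝ, 0 < p → p < pcOf adjT P →
          Tendsto (fun x : Site => -Real.log (tauEnh adjT φ (P p) (P s) x) / siteNorm x)
            (comap siteNorm atTop) (𝓝 (ξ' p)⁻¹)) ∧
        Tendsto (fun p => Real.log (ξ' p) / Real.log (pcOf adjT P - p))
          (𝓝[<] (pcOf adjT P)) (𝓝 (-νexp))) ∧
    -- (iv) the exponent γ (mean cluster size)
    (∀ γexp : ℝ,
      Tendsto (fun p => Real.log (chi adjT (P p)).toReal / Real.log (pcOf adjT P - p))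
        (𝓝[<] (pcOf adjT P)) (𝓝 (-γexp)) →
      Tendsto (fun p =>
          Real.log (chiEnh adjT φ (P p) (P s)).toReal / Real.log (pcOf adjT P - p))
        (𝓝[<] (pcOf adjT P)) (𝓝 (-γexp))) := by
  obtain ⟨hpc0, hpc1⟩ := pcOf_bounds hP
  set pc := pcOf adjT P with hpc
  have hν : IsProbabilityMeasure (P s) := (hP s hs).1
  have hnorm : Tendsto siteNorm (comap siteNorm atTop) atTop := tendsto_comap
  obtain ⟨c, hc, hcomp⟩ := exists_comparison hφ hmono hness (half_pos hpc0)
  have hleft : ∀ᶠ p in 𝓝[<] pc, pc / 2 ≤ p ∧ p < pc := by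
    filter_upwards [Ioo_mem_nhdsLT (half_lt_self hpc0)] with p hp
    exact ⟨hp.1.le, hp.2⟩
  refine ⟨fun β h => ?_, fun η h => ?_, fun ν ξ hξ h => ⟨ξ, fun p hp0 hp => ?_, h⟩, fun γ h => ?_⟩
  · refine tendsto_log_div_of_comparable hc (fun _ => ENNReal.toReal_nonneg) ?_
      (tendsto_inv_log_sub_nhdsGT pc) h
    filter_upwards [Ioo_mem_nhdsGT hpc1] with p hp
    have hp0 := hpc0.trans hp.1
    exact (hcomp p _ _ (by linarith [hp.1]) hp.2.le (hP p ⟨hp0.le, hp.2.le⟩) hν).2.1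
  · exact tendsto_log_div_of_comparable hc (fun _ => ENNReal.toReal_nonneg)
      (Eventually.of_forall
        (hcomp pc _ _ (half_le_self hpc0.le) hpc1.le (hP pc ⟨hpc0.le, hpc1.le⟩) hν).1)
      (tendsto_inv_atTop_zero.comp (Real.tendsto_log_atTop.comp hnorm)) h
  · obtain ⟨c', hc', hcomp'⟩ := exists_comparison hφ hmono hness hp0
    have hp1 := (hp.trans hpc1).le
    have h1 := (hξ p hp0 hp).neg
    simp only [neg_div, neg_neg] at h1 ⊢
    have h2 := (tendsto_log_div_of_comparable hc' (fun _ => ENNReal.toReal_nonneg)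
      (Eventually.of_forall (hcomp' p _ (P s) le_rfl hp1 (hP p ⟨hp0.le, hp1⟩) hν).1)
      (tendsto_inv_atTop_zero.comp hnorm) h1).neg
    simpa only [neg_neg] using h2
  · refine tendsto_log_div_of_comparable hc (fun _ => ENNReal.toReal_nonneg) ?_
      (tendsto_inv_log_sub_nhdsLT pc) h
    filter_upwards [hleft] with p hp
    have hp1 := (hp.2.trans hpc1).le
    exact (hcomp p _ _ hp.1 hp1 (hP p ⟨(half_pos hpc0).le.trans hp.1, hp1⟩) hν).2.2

end PercEnh
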